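/- Suppose (M, M', β) ∈ ℳ, let G be a graph lift of M on n vertices with parts V_1, …, V_k, let m be a positive integer, and set σ = Σ_{i,j} √(M_{ij}). Assume: (a) λ₂(A_G) ≤ λ₁(M'); (b) at most m eigenvalues of A_G (with multiplicity) exceed σ; (c) A_G possesses an orthonormal eigenbasis, a subset of which is a basis for the space of vectors in ℝ^{V(G)} constant on each part V_i, in which every eigenvector with eigenvalue greater than σ has all entries at most √(m/n) in absolute value; (d) n > m⁹. Then there exists an M'-signing s of G whose adjacency matrix A_s satisfies λ₁(A_s) = λ₁(M'). -/

import Mathlib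

open Matrix

/-- The adjacency matrix of a finite simple graph, with real entries. -/
noncomputable def adjMat {V : Type*} [Fintype V] (G : SimpleGraph V) : Matrix V V ℝ :=
  letI := Classical.decRel G.Adj
  G.adjMatrix ℝ

/-- The eigenvalues of a real (symmetric) matrix, i.e. the real roots of its characteristic
polynomial with multiplicity, listed in decreasing order. -/
noncomputable def eigList {V : Type*} [Fintype V] [DecidableEq V] (A : Matrix V V ℝ) : List ℝ :=
  (A.charpoly.roots.sort (· ≤ ·)).reverse

/-- `lam A i` is `λ_i(A)`, the `i`-th largest eigenvalue (counted with multiplicity, 1-indexed)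
of a real symmetric matrix `A`. -/
noncomputable def lam {V : Type*} [Fintype V] [DecidableEq V] (A : Matrix V V ℝ) (i : ℕ) : ℝ :=
  (eigList A).getD (i - 1) 0

/-- A nonnegative square matrix is irreducible iff the associated (multi)graph is connected:
between any two distinct indices there is a walk. -/
def Irred {k : ℕ} (M : Matrix (Fin k) (Fin k) ℕ) : Prop :=
  ∀ i j, i ≠ j → ∃ n : ℕ, 0 < (M ^ n) i j

/-- A graph lift of a symmetric nonnegative integer matrix `M` with zero diagonal: a
`k`-partite graph `G`, with parts `V_i = P⁻¹(i)`, such that for `i ≠ j` the bipartite graph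
between `V_i` and `V_j` is `M i j`-regular. -/
structure IsGraphLift {V : Type*} [Fintype V] {k : ℕ} (M : Matrix (Fin k) (Fin k) ℕ)
    (G : SimpleGraph V) (P : V → Fin k) : Prop where
  parts_cover : Function.Surjective P
  not_adj_within : ∀ v w, G.Adj v w → P v ≠ P w
  between_regular : ∀ (v : V) (j : Fin k), j ≠ P v →
    {w : V | G.Adj v w ∧ P w = j}.ncard = M (P v) j

/-- `M'` is a sign matrix of `M`: a symmetric integer matrix with `M' i j ≡ M i j (mod 2)`
and `|M' i j| ≤ M i j` for all `i, j`. -/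
def IsSignMatrix {k : ℕ} (M : Matrix (Fin k) (Fin k) ℕ) (M' : Matrix (Fin k) (Fin k) ℤ) :
    Prop :=
  M'.IsSymm ∧ ∀ i j, (2 : ℤ) ∣ (M' i j - (M i j : ℤ)) ∧ |M' i j| ≤ (M i j : ℤ)

/-- A natural number matrix viewed as a real matrix. -/
def natToReal {k : ℕ} (M : Matrix (Fin k) (Fin k) ℕ) : Matrix (Fin k) (Fin k) ℝ :=
  Matrix.of fun i j => (M i j : ℝ)

/-- An integer matrix viewed as a real matrix. -/
def intToReal {k : ℕ} (M' : Matrix (Fin k) (Fin k) ℤ) : Matrix (Fin k) (Fin k) ℝ :=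
  Matrix.of fun i j => (M' i j : ℝ)

/-- The matrix `D = (M - M')/2`. -/
noncomputable def DMat {k : ℕ} (M : Matrix (Fin k) (Fin k) ℕ)
    (M' : Matrix (Fin k) (Fin k) ℤ) : Matrix (Fin k) (Fin k) ℝ :=
  (1 / 2 : ℝ) • (natToReal M - intToReal M')

/-- Entrywise absolute value of a real matrix. -/
def absMat {k : ℕ} (A : Matrix (Fin k) (Fin k) ℝ) : Matrix (Fin k) (Fin k) ℝ :=
  Matrix.of fun i j => |A i j|

/-- `σ = Σ_{i,j} √(M_{ij})`. -/
noncomputable def sigmaM {k : ℕ} (M : Matrix (Fin k) (Fin k) ℕ) : ℝ :=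
  ∑ i, ∑ j, Real.sqrt (M i j)

/-- The set `ℳ` of triples `(M, M', β)`: `M` is an irreducible symmetric nonnegative integer
matrix with zero diagonal, `M'` is a sign matrix of `M`, `β ∈ (0, 1/2)`, and (with
`D = (M - M')/2`, `γ = λ₁(|D - βM|)`, `σ = Σ_{i,j} √(M_{ij})`) the matrix
`[[(1-2β)λ₁(M') + 2γ + 7σ, 2λ₁(D)], [2λ₁(D), 2λ₁(D) + σ]]` has top eigenvalue at most
`λ₁(M')`. -/
structure MemM {k : ℕ} (M : Matrix (Fin k) (Fin k) ℕ) (M' : Matrix (Fin k) (Fin k) ℤ)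
    (β : ℝ) : Prop where
  symm : M.IsSymm
  diag : ∀ i, M i i = 0
  irr : Irred M
  signMatrix : IsSignMatrix M M'
  beta_mem : β ∈ Set.Ioo (0 : ℝ) (1 / 2)
  eig_cond :
    lam !![(1 - 2 * β) * lam (intToReal M') 1 +
             2 * lam (absMat (DMat M M' - β • natToReal M)) 1 + 7 * sigmaM M,
           2 * lam (DMat M M') 1;
           2 * lam (DMat M M') 1,
           2 * lam (DMat M M') 1 + sigmaM M] 1 ≤ lam (intToReal M') 1

/-- An `M'`-signing of a graph lift `G` of `M`: an assignment of `±1` to each edge such that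
for all `i, j` and each vertex `x ∈ V_i`, the signs of the edges from `x` to `V_j` sum to
`M' i j`. -/
structure IsMSigning {V : Type*} [Fintype V] {k : ℕ} (M' : Matrix (Fin k) (Fin k) ℤ)
    (G : SimpleGraph V) (P : V → Fin k) (s : V → V → ℤ) : Prop where
  symm : ∀ x y, s x y = s y x
  sign : ∀ x y, G.Adj x y → s x y = 1 ∨ s x y = -1
  rowsum : ∀ (x : V) (j : Fin k), j ≠ P x →
    (∑ y : V, {y' : V | G.Adj x y' ∧ P y' = j}.indicator (s x) y) = M' (P x) j

/-- The adjacency matrix of a signing `s` of the graph `G`: entries of `A_G` corresponding to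
edges are replaced by the sign of the edge. -/
noncomputable def signAdj {V : Type*} [Fintype V] (G : SimpleGraph V) (s : V → V → ℤ) :
    Matrix V V ℝ :=
  Matrix.of fun x y =>
    letI := Classical.propDecidable (G.Adj x y)
    if G.Adj x y then (s x y : ℝ) else 0

/-- The subspace of `ℝ^V` of vectors constant on each part `P⁻¹(i)`. -/
def constOnParts {V : Type*} {k : ℕ} (P : V → Fin k) : Submodule ℝ (V → ℝ) where
  carrier := {f | ∀ x y, P x = P y → f x = f y}
  add_mem' := by
    intro f g hf hg x y h
    simp only [Pi.add_apply]
    rw [hf x y h, hg x y h]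
  zero_mem' := by intro x y h; rfl
  smul_mem' := by
    intro c f hf x y h
    simp only [Pi.smul_apply]
    rw [hf x y h]


/-! ### Linear algebra preliminaries -/

lemma onb_expand {n : Type*} [Fintype n] [DecidableEq n] (b : n → (n → ℝ))
    (horth : ∀ i j, b i ⬝ᵥ b j = if i = j then (1 : ℝ) else 0) (x : n → ℝ) :
    x = ∑ i, (b i ⬝ᵥ x) • b i := by
  have h1 : (Matrix.of b) * (Matrix.of b)ᵀ = 1 := by
    ext i j
    rw [Matrix.mul_apply, Matrix.one_apply]
    exact horth i j
  have h2 : (Matrix.of b)ᵀ * (Matrix.of b) = 1 := mul_eq_one_comm.mp h1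
  have h3 : x = (Matrix.of b)ᵀ *ᵥ ((Matrix.of b) *ᵥ x) := by
    rw [Matrix.mulVec_mulVec, h2, Matrix.one_mulVec]
  conv_lhs => rw [h3]
  ext v
  simp only [Matrix.mulVec, dotProduct, Matrix.transpose_apply, Matrix.of_apply,
    Finset.sum_apply, Pi.smul_apply, smul_eq_mul]
  exact Finset.sum_congr rfl fun i _ => mul_comm _ _

lemma onb_roots {n : Type*} [Fintype n] [DecidableEq n] (A : Matrix n n ℝ) (b : n → (n → ℝ))
    (μ : n → ℝ) (heig : ∀ i, A.mulVec (b i) = μ i • b i)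
    (horth : ∀ i j, b i ⬝ᵥ b j = if i = j then (1 : ℝ) else 0) :
    A.charpoly.roots = Finset.univ.val.map μ := by
  have h1 : (Matrix.of b) * (Matrix.of b)ᵀ = 1 := by
    ext i j
    rw [Matrix.mul_apply, Matrix.one_apply]
    exact horth i j
  have h2 : (Matrix.of b)ᵀ * (Matrix.of b) = 1 := mul_eq_one_comm.mp h1
  have h3 : A * (Matrix.of b)ᵀ = (Matrix.of b)ᵀ * Matrix.diagonal μ := by
    ext v i
    rw [Matrix.mul_diagonal, Matrix.mul_apply]
    have := congrFun (heig i) v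
    simp only [Matrix.mulVec, dotProduct, Pi.smul_apply, smul_eq_mul] at this
    simp only [Matrix.transpose_apply, Matrix.of_apply]
    rw [this, mul_comm]
  have h4 : A = (Matrix.of b)ᵀ * (Matrix.diagonal μ * Matrix.of b) := by
    rw [← mul_assoc, ← h3, mul_assoc, h2, mul_one]
  rw [h4, Matrix.charpoly_mul_comm, mul_assoc, h1, mul_one, Matrix.charpoly_diagonal]
  rw [Polynomial.roots_prod]
  · simp
  · exact Finset.prod_ne_zero_iff.mpr fun i _ => Polynomial.X_sub_C_ne_zero _

lemma exists_onb {n : Type*} [Fintype n] [DecidableEq n] (A : Matrix n n ℝ) (hA : A.IsSymm) :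
    ∃ (b : n → (n → ℝ)) (μ : n → ℝ), (∀ i, A.mulVec (b i) = μ i • b i) ∧
      (∀ i j, b i ⬝ᵥ b j = if i = j then (1 : ℝ) else 0) := by
  have hH : A.IsHermitian := by
    rw [Matrix.IsHermitian, Matrix.conjTranspose_eq_transpose_of_trivial]; exact hA
  refine ⟨fun i => (hH.eigenvectorBasis i).ofLp, hH.eigenvalues, fun i => hH.mulVec_eigenvectorBasis i, ?_⟩
  intro i j
  have h := orthonormal_iff_ite.mp hH.eigenvectorBasis.orthonormal j i
  rw [EuclideanSpace.inner_eq_star_dotProduct] at h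
  simp only [star_trivial] at h
  rw [h]
  simp [eq_comm]

lemma le_lam_one {n : Type*} [Fintype n] [DecidableEq n] (A : Matrix n n ℝ) (r : ℝ)
    (hr : r ∈ A.charpoly.roots) : r ≤ lam A 1 := by
  unfold lam eigList
  set L := A.charpoly.roots.sort (· ≤ ·) with hL
  have hs : L.Pairwise (· ≤ ·) := Multiset.pairwise_sort _ _
  have hm : r ∈ L.reverse := by simpa [hL] using hr
  have hs' : L.reverse.Pairwise (· ≥ ·) := by
    rw [List.pairwise_reverse]; exact hs
  cases hh : L.reverse with
  | nil => simp [hh] at hm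
  | cons a l =>
    rw [hh] at hm hs'
    rw [List.pairwise_cons] at hs'
    simp only [Nat.sub_self, List.getD_cons_zero]
    rcases List.mem_cons.mp hm with h | h
    · exact h.le
    · exact hs'.1 r h

lemma lam_one_mem {n : Type*} [Fintype n] [DecidableEq n] (A : Matrix n n ℝ)
    (hr : A.charpoly.roots ≠ 0) : lam A 1 ∈ A.charpoly.roots := by
  unfold lam eigList
  have key : ∀ x, x ∈ A.charpoly.roots ↔ x ∈ (A.charpoly.roots.sort (· ≤ ·)).reverse := by
    intro x; simp
  cases hh : (A.charpoly.roots.sort (· ≤ ·)).reverse with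
  | nil =>
    exfalso
    apply hr
    apply Multiset.eq_zero_of_forall_notMem
    intro x hx
    rw [key, hh] at hx
    simp at hx
  | cons a l =>
    rw [key, hh]; simp

lemma le_lam_two {n : Type*} [Fintype n] [DecidableEq n] (A : Matrix n n ℝ) (b : n → (n → ℝ))
    (μ : n → ℝ) (heig : ∀ i, A.mulVec (b i) = μ i • b i)
    (horth : ∀ i j, b i ⬝ᵥ b j = if i = j then (1 : ℝ) else 0) (i j : n) (hij : i ≠ j) (c : ℝ)
    (hi : c ≤ μ i) (hj : c ≤ μ j) : c ≤ lam A 2 := by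
  unfold lam eigList
  have hroots := onb_roots A b μ heig horth
  set L := A.charpoly.roots.sort (· ≤ ·) with hL
  have hs : L.Pairwise (· ≤ ·) := Multiset.pairwise_sort _ _
  have hs' : L.reverse.Pairwise (· ≥ ·) := by
    rw [List.pairwise_reverse]; exact hs
  have hcoe : (L.reverse : Multiset ℝ) = Finset.univ.val.map μ := by
    rw [← hroots, ← Multiset.sort_eq A.charpoly.roots (· ≤ ·), Multiset.coe_reverse, ← hL]
  have hsplit : (Finset.univ.val.map μ) =
      μ i ::ₘ μ j ::ₘ ((Finset.univ.erase i).erase j).val.map μ := by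
    rw [← Multiset.map_cons, ← Finset.insert_val_of_notMem (by simp),
      Finset.insert_erase (by simp [hij.symm]), ← Multiset.map_cons,
      ← Finset.insert_val_of_notMem (by simp), Finset.insert_erase (by simp)]
  rw [hsplit] at hcoe
  have hcard : 2 ≤ Multiset.countP (fun x => c ≤ x) (L.reverse : Multiset ℝ) := by
    rw [hcoe, Multiset.countP_cons_of_pos _ hi, Multiset.countP_cons_of_pos _ hj]
    omega
  rw [Multiset.coe_countP] at hcard
  match hh : L.reverse with
  | [] => rw [hh] at hcard; simp at hcard
  | [a] =>
    rw [hh] at hcard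
    have := List.countP_le_length (p := fun x => decide (c ≤ x)) (l := [a])
    simp only [List.length_singleton] at this
    omega
  | a :: a' :: l =>
    rw [hh] at hcard hs'
    simp only [List.getD_cons_succ, Nat.add_one_sub_one, List.getD_cons_zero]
    by_contra hlt
    push Not at hlt
    rw [List.pairwise_cons, List.pairwise_cons] at hs'
    have h0 : List.countP (fun x => decide (c ≤ x)) (a' :: l) = 0 := by
      rw [List.countP_eq_zero]
      intro x hx
      rcases List.mem_cons.mp hx with h | h
      · simp [h, hlt]
      · have := hs'.2.1 x h
        simp only [decide_eq_true_eq, not_le]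
        linarith
    rw [List.countP_cons, h0] at hcard
    split_ifs at hcard <;> omega

lemma onb_quad {n : Type*} [Fintype n] [DecidableEq n] (A : Matrix n n ℝ) (b : n → (n → ℝ))
    (μ : n → ℝ) (heig : ∀ i, A.mulVec (b i) = μ i • b i)
    (horth : ∀ i j, b i ⬝ᵥ b j = if i = j then (1 : ℝ) else 0) (S : Finset n) (c : n → ℝ) :
    (∑ i ∈ S, c i • b i) ⬝ᵥ A *ᵥ (∑ i ∈ S, c i • b i) = ∑ i ∈ S, μ i * c i ^ 2 := by
  rw [Matrix.mulVec_sum, sum_dotProduct]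
  apply Finset.sum_congr rfl
  intro i hi
  rw [dotProduct_sum, Finset.sum_eq_single_of_mem i hi]
  · rw [Matrix.mulVec_smul, heig, smul_dotProduct, dotProduct_smul, dotProduct_smul, horth]
    simp; ring
  · intro j _ hj
    rw [Matrix.mulVec_smul, heig, smul_dotProduct, dotProduct_smul, dotProduct_smul, horth,
      if_neg hj.symm]
    simp

lemma onb_norm {n : Type*} [Fintype n] [DecidableEq n] (b : n → (n → ℝ))
    (horth : ∀ i j, b i ⬝ᵥ b j = if i = j then (1 : ℝ) else 0) (S : Finset n) (c : n → ℝ) :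
    (∑ i ∈ S, c i • b i) ⬝ᵥ (∑ i ∈ S, c i • b i) = ∑ i ∈ S, c i ^ 2 := by
  have := onb_quad 1 b (fun _ => 1) (by simp) horth S c
  simpa using this

lemma onb_disj {n : Type*} [Fintype n] [DecidableEq n] (b : n → (n → ℝ))
    (horth : ∀ i j, b i ⬝ᵥ b j = if i = j then (1 : ℝ) else 0) (S T : Finset n)
    (hST : Disjoint S T) (c d : n → ℝ) :
    (∑ i ∈ S, c i • b i) ⬝ᵥ (∑ i ∈ T, d i • b i) = 0 := by
  rw [sum_dotProduct]
  apply Finset.sum_eq_zero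
  intro i hi
  rw [dotProduct_sum]
  apply Finset.sum_eq_zero
  intro j hj
  rw [smul_dotProduct, dotProduct_smul, horth, if_neg]
  · simp
  · rintro rfl
    exact Finset.disjoint_left.mp hST hi hj

lemma rayleigh {n : Type*} [Fintype n] [DecidableEq n] (A : Matrix n n ℝ) (hA : A.IsSymm)
    (x : n → ℝ) : x ⬝ᵥ A *ᵥ x ≤ lam A 1 * (x ⬝ᵥ x) := by
  obtain ⟨b, μ, heig, horth⟩ := exists_onb A hA
  have hx := onb_expand b horth x
  have h1 := onb_quad A b μ heig horth Finset.univ (fun i => b i ⬝ᵥ x)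
  have h2 := onb_norm b horth Finset.univ (fun i => b i ⬝ᵥ x)
  rw [← hx] at h1 h2
  rw [h1, h2, Finset.mul_sum]
  apply Finset.sum_le_sum
  intro i _
  apply mul_le_mul_of_nonneg_right _ (sq_nonneg _)
  apply le_lam_one
  rw [onb_roots A b μ heig horth]
  exact Multiset.mem_map_of_mem _ (Finset.mem_univ i)

lemma lam_eigvec {n : Type*} [Fintype n] [DecidableEq n] [Nonempty n] (A : Matrix n n ℝ)
    (hA : A.IsSymm) : ∃ p : n → ℝ, p ⬝ᵥ p = 1 ∧ A *ᵥ p = lam A 1 • p := by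
  obtain ⟨b, μ, heig, horth⟩ := exists_onb A hA
  have hr := onb_roots A b μ heig horth
  have hmem := lam_one_mem A (by
    rw [hr]
    intro h
    have h' := congrArg Multiset.card h
    simp at h')
  rw [hr] at hmem
  obtain ⟨i, _, hi⟩ := Multiset.mem_map.mp hmem
  exact ⟨b i, by rw [horth, if_pos rfl], by rw [← hi]; exact heig i⟩

lemma symm_dot {n : Type*} [Fintype n] (A : Matrix n n ℝ) (hA : A.IsSymm)
    (x y : n → ℝ) : x ⬝ᵥ A *ᵥ y = y ⬝ᵥ A *ᵥ x := by
  rw [Matrix.dotProduct_mulVec, ← Matrix.mulVec_transpose, hA.eq, dotProduct_comm]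

lemma lam_le {n : Type*} [Fintype n] [DecidableEq n] [Nonempty n] (A : Matrix n n ℝ)
    (hA : A.IsSymm) (c : ℝ) (h : ∀ x : n → ℝ, x ⬝ᵥ A *ᵥ x ≤ c * (x ⬝ᵥ x)) : lam A 1 ≤ c := by
  obtain ⟨p, hp, hp'⟩ := lam_eigvec A hA
  have := h p
  rw [hp', dotProduct_smul, hp] at this
  simpa using this

/-- Bilinear bound for nonnegative symmetric matrices. -/
lemma nonneg_bilin {n : Type*} [Fintype n] [DecidableEq n] [Nonempty n] (W : Matrix n n ℝ)
    (hW : W.IsSymm) (h0 : ∀ i j, 0 ≤ W i j) (a b : n → ℝ) :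
    0 ≤ lam W 1 ∧ a ⬝ᵥ W *ᵥ b ≤ lam W 1 * (√(a ⬝ᵥ a) * √(b ⬝ᵥ b)) := by
  have hnn : ∀ z : n → ℝ, 0 ≤ z ⬝ᵥ z := fun z => by
    unfold dotProduct
    exact Finset.sum_nonneg fun i _ => mul_self_nonneg _
  have hlow : ∀ z : n → ℝ, -(lam W 1 * (z ⬝ᵥ z)) ≤ z ⬝ᵥ W *ᵥ z := by
    intro z
    have h1 := rayleigh W hW (fun i => |z i|)
    have h2 : (fun i => |z i|) ⬝ᵥ (fun i => |z i|) = z ⬝ᵥ z := by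
      simp [dotProduct, abs_mul_abs_self]
    rw [h2] at h1
    have h3 : -(z ⬝ᵥ W *ᵥ z) ≤ (fun i => |z i|) ⬝ᵥ W *ᵥ (fun i => |z i|) := by
      simp only [dotProduct, Matrix.mulVec, Finset.mul_sum]
      rw [← Finset.sum_neg_distrib]
      apply Finset.sum_le_sum
      intro i _
      rw [← Finset.sum_neg_distrib]
      apply Finset.sum_le_sum
      intro j _
      have : z i * (W i j * z j) = W i j * (z i * z j) := by ring
      rw [this]
      have : |z i| * (W i j * |z j|) = W i j * (|z i * z j|) := by rw [abs_mul]; ring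
      rw [this]
      have := neg_abs_le (z i * z j)
      nlinarith [h0 i j]
    linarith
  have hpos : 0 ≤ lam W 1 := by
    obtain ⟨p, hp, hp'⟩ := lam_eigvec W hW
    have h1 := hlow p
    rw [hp', dotProduct_smul, hp] at h1
    simp at h1
    linarith
  refine ⟨hpos, ?_⟩
  have hd : discrim (lam W 1 * (a ⬝ᵥ a)) (-(2 * (a ⬝ᵥ W *ᵥ b))) (lam W 1 * (b ⬝ᵥ b)) ≤ 0 := by
    apply discrim_le_zero
    intro t
    have h1 := rayleigh W hW (t • a + b)
    have h2 := hlow (t • a - b)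
    have hs := symm_dot W hW b a
    simp only [Matrix.mulVec_add, Matrix.mulVec_sub, Matrix.mulVec_smul, dotProduct_add,
      add_dotProduct, smul_dotProduct, dotProduct_smul, dotProduct_sub, sub_dotProduct,
      smul_eq_mul] at h1 h2
    rw [hs] at h1 h2
    nlinarith
  rw [discrim] at hd
  have h4 : (a ⬝ᵥ W *ᵥ b) ^ 2 ≤ (lam W 1 * (√(a ⬝ᵥ a) * √(b ⬝ᵥ b))) ^ 2 := by
    rw [mul_pow, mul_pow, Real.sq_sqrt (hnn a), Real.sq_sqrt (hnn b)]
    nlinarith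
  exact (abs_le_of_sq_le_sq' h4 (by positivity)).2

/-! ### Block matrices -/

lemma dot_self_nonneg' {n : Type*} [Fintype n] (z : n → ℝ) : 0 ≤ z ⬝ᵥ z := by
  unfold dotProduct
  exact Finset.sum_nonneg fun i _ => mul_self_nonneg _

lemma block_bilin {k n : ℕ} [Nonempty (Fin k)] (P : Fin n → Fin k) (B : Matrix (Fin n) (Fin n) ℝ)
    (hB : B.IsSymm) (W : Matrix (Fin k) (Fin k) ℝ) (hW : W.IsSymm) (h0 : ∀ i j, 0 ≤ W i j)
    (hrow : ∀ v j, ∑ w ∈ Finset.univ.filter (fun w => P w = j), |B v w| ≤ W (P v) j)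
    (x y : Fin n → ℝ) :
    x ⬝ᵥ B *ᵥ y ≤ lam W 1 * (√(x ⬝ᵥ x) * √(y ⬝ᵥ y)) := by
  have hnorm : ∀ x : Fin n → ℝ,
      (fun i => √(∑ v ∈ Finset.univ.filter (fun v => P v = i), x v ^ 2)) ⬝ᵥ
      (fun i => √(∑ v ∈ Finset.univ.filter (fun v => P v = i), x v ^ 2)) = x ⬝ᵥ x := by
    intro x
    simp only [dotProduct]
    rw [← Finset.sum_fiberwise Finset.univ P]
    apply Finset.sum_congr rfl
    intro i _
    rw [Real.mul_self_sqrt (Finset.sum_nonneg fun v _ => sq_nonneg _)]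
    exact Finset.sum_congr rfl fun v _ => by ring
  have key := (nonneg_bilin W hW h0
    (fun i => √(∑ v ∈ Finset.univ.filter (fun v => P v = i), x v ^ 2))
    (fun i => √(∑ v ∈ Finset.univ.filter (fun v => P v = i), y v ^ 2))).2
  rw [hnorm x, hnorm y] at key
  refine le_trans ?_ key
  have e1 : x ⬝ᵥ B *ᵥ y = ∑ i, ∑ j, ∑ v ∈ Finset.univ.filter (fun v => P v = i),
      ∑ w ∈ Finset.univ.filter (fun w => P w = j), x v * (B v w * y w) := by
    simp only [dotProduct, Matrix.mulVec, Finset.mul_sum]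
    rw [← Finset.sum_fiberwise Finset.univ P]
    apply Finset.sum_congr rfl
    intro i _
    symm
    rw [Finset.sum_comm]
    apply Finset.sum_congr rfl
    intro v _
    rw [Finset.sum_fiberwise Finset.univ P]
  rw [e1]
  simp only [dotProduct, Matrix.mulVec, Finset.mul_sum]
  apply Finset.sum_le_sum
  intro i _
  apply Finset.sum_le_sum
  intro j _
  set S := Finset.univ.filter (fun v => P v = i)
  set T := Finset.univ.filter (fun w => P w = j)
  rw [← Finset.sum_product']
  have c1 : ∑ p ∈ S ×ˢ T, x p.1 * (B p.1 p.2 * y p.2) ≤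
      ∑ p ∈ S ×ˢ T, (√|B p.1 p.2| * |x p.1|) * (√|B p.1 p.2| * |y p.2|) := by
    apply Finset.sum_le_sum
    intro p _
    calc x p.1 * (B p.1 p.2 * y p.2) ≤ |x p.1 * (B p.1 p.2 * y p.2)| := le_abs_self _
      _ = |B p.1 p.2| * |x p.1| * |y p.2| := by rw [abs_mul, abs_mul]; ring
      _ = (√|B p.1 p.2| * √|B p.1 p.2|) * |x p.1| * |y p.2| := by
          rw [Real.mul_self_sqrt (abs_nonneg _)]
      _ = _ := by ring
  refine c1.trans ((Real.sum_mul_le_sqrt_mul_sqrt _ _ _).trans ?_)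
  have d1 : ∑ p ∈ S ×ˢ T, (√|B p.1 p.2| * |x p.1|) ^ 2 ≤ W i j * ∑ v ∈ S, x v ^ 2 := by
    rw [Finset.sum_product, Finset.mul_sum]
    apply Finset.sum_le_sum
    intro v hv
    have hv' : P v = i := (Finset.mem_filter.mp hv).2
    simp only [mul_pow, sq_abs, Real.sq_sqrt (abs_nonneg _)]
    rw [← Finset.sum_mul]
    have := hrow v j
    rw [hv'] at this
    exact mul_le_mul_of_nonneg_right this (sq_nonneg _)
  have d2 : ∑ p ∈ S ×ˢ T, (√|B p.1 p.2| * |y p.2|) ^ 2 ≤ W i j * ∑ w ∈ T, y w ^ 2 := by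
    rw [Finset.sum_product_right, Finset.mul_sum]
    apply Finset.sum_le_sum
    intro v hv
    have hv' : P v = j := (Finset.mem_filter.mp hv).2
    simp only [mul_pow, sq_abs, Real.sq_sqrt (abs_nonneg _)]
    rw [← Finset.sum_mul]
    have := hrow v i
    rw [hv', hW.apply i j] at this
    refine mul_le_mul_of_nonneg_right (le_trans (le_of_eq ?_) this) (sq_nonneg _)
    exact Finset.sum_congr rfl fun w _ => by rw [hB.apply]
  calc _ ≤ √(W i j * ∑ v ∈ S, x v ^ 2) * √(W i j * ∑ w ∈ T, y w ^ 2) :=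
        mul_le_mul (Real.sqrt_le_sqrt d1) (Real.sqrt_le_sqrt d2) (Real.sqrt_nonneg _)
          (Real.sqrt_nonneg _)
    _ = (√(W i j) * √(W i j)) * (√(∑ v ∈ S, x v ^ 2) * √(∑ w ∈ T, y w ^ 2)) := by
        rw [Real.sqrt_mul (h0 i j), Real.sqrt_mul (h0 i j)]; ring
    _ = _ := by rw [Real.mul_self_sqrt (h0 i j)]; ring

lemma lift_mulVec {k n : ℕ} (P : Fin n → Fin k) (B : Matrix (Fin n) (Fin n) ℝ)
    (W : Matrix (Fin k) (Fin k) ℝ)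
    (hrow : ∀ v j, ∑ w ∈ Finset.univ.filter (fun w => P w = j), B v w = W (P v) j)
    (p : Fin k → ℝ) : B *ᵥ (p ∘ P) = (W *ᵥ p) ∘ P := by
  ext v
  simp only [Matrix.mulVec, dotProduct, Function.comp]
  rw [← Finset.sum_fiberwise Finset.univ P]
  apply Finset.sum_congr rfl
  intro j _
  rw [← hrow v j, Finset.sum_mul]
  apply Finset.sum_congr rfl
  intro w hw
  rw [(Finset.mem_filter.mp hw).2]

lemma lift_quad {k n : ℕ} (P : Fin n → Fin k) (B : Matrix (Fin n) (Fin n) ℝ)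
    (hB : B.IsSymm) (W : Matrix (Fin k) (Fin k) ℝ) (hW : W.IsSymm)
    (hrow : ∀ v j, ∑ w ∈ Finset.univ.filter (fun w => P w = j), B v w = W (P v) j)
    (p : Fin k → ℝ) : (p ∘ P) ⬝ᵥ B *ᵥ (p ∘ P) ≤ lam W 1 * ((p ∘ P) ⬝ᵥ (p ∘ P)) := by
  rw [lift_mulVec P B W hrow]
  set N : Fin k → ℝ := fun i => ((Finset.univ.filter (fun v => P v = i)).card : ℝ) with hN
  have hN0 : ∀ i, 0 ≤ N i := fun i => Nat.cast_nonneg _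
  have hsum : ∀ f g : Fin k → ℝ, (f ∘ P) ⬝ᵥ (g ∘ P) = ∑ i, N i * (f i * g i) := by
    intro f g
    simp only [dotProduct, Function.comp]
    rw [← Finset.sum_fiberwise Finset.univ P]
    apply Finset.sum_congr rfl
    intro i _
    rw [Finset.sum_congr rfl (g := fun _ => f i * g i), Finset.sum_const, nsmul_eq_mul]
    intro v hv
    rw [(Finset.mem_filter.mp hv).2]
  have hNW : ∀ i j, N i * W i j = N j * W i j := by
    intro i j
    have h1 : ∀ i j, ∑ v ∈ Finset.univ.filter (fun v => P v = i),
        ∑ w ∈ Finset.univ.filter (fun w => P w = j), B v w = N i * W i j := by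
      intro i j
      rw [Finset.sum_congr rfl (g := fun _ => W i j), Finset.sum_const, nsmul_eq_mul]
      intro v hv
      rw [hrow, (Finset.mem_filter.mp hv).2]
    have h2 : N i * W i j = N j * W j i := by
      rw [← h1 i j, ← h1 j i]
      refine Finset.sum_comm.trans ?_
      exact Finset.sum_congr rfl fun v _ => Finset.sum_congr rfl fun w _ => hB.apply _ _
    rw [h2, hW.apply i j]
  have hNW' : ∀ i j, √(N i) * √(N j) * W i j = N i * W i j := by
    intro i j
    by_cases h : W i j = 0
    · simp [h]
    · have := mul_right_cancel₀ h (hNW i j)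
      rw [← this, Real.mul_self_sqrt (hN0 i)]
  have hr := rayleigh W hW (fun i => √(N i) * p i)
  rw [hsum, hsum]
  have e1 : (fun i => √(N i) * p i) ⬝ᵥ (fun i => √(N i) * p i) = ∑ i, N i * (p i * p i) := by
    simp only [dotProduct]
    refine Finset.sum_congr rfl fun i _ => ?_
    nth_rewrite 3 [← Real.mul_self_sqrt (hN0 i)]
    ring
  have e2 : (fun i => √(N i) * p i) ⬝ᵥ W *ᵥ (fun i => √(N i) * p i) =
      ∑ i, N i * (p i * (W *ᵥ p) i) := by
    simp only [dotProduct, Matrix.mulVec, Finset.mul_sum]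
    refine Finset.sum_congr rfl fun i _ => Finset.sum_congr rfl fun j _ => ?_
    have := hNW' i j
    linear_combination (p i * p j) * this
  rw [e1, e2] at hr
  exact hr

/-! ### Rounding -/

open Classical in
lemma round_step {E Z : Type*} [Fintype E] [AddCommGroup Z] [Module ℝ Z]
    (L : (E → ℝ) →ₗ[ℝ] Z) (x : E → ℝ) (hx : ∀ e, 0 ≤ x e ∧ x e ≤ 1) (z : E → ℝ) (hz : z ≠ 0)
    (hzs : ∀ e, (x e = 0 ∨ x e = 1) → z e = 0) (hLz : L z = 0) :
    ∃ x' : E → ℝ, (∀ e, 0 ≤ x' e ∧ x' e ≤ 1) ∧ L x' = L x ∧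
      (∀ e, (x e = 0 ∨ x e = 1) → x' e = x e) ∧
      ∃ e, ¬ (x e = 0 ∨ x e = 1) ∧ (x' e = 0 ∨ x' e = 1) := by
  obtain ⟨e0, he0⟩ : ∃ e, z e ≠ 0 := by
    by_contra h
    push Not at h
    exact hz (funext h)
  let τ : E → ℝ := fun e => if 0 < z e then (1 - x e) / z e else x e / (-z e)
  obtain ⟨e1, he1, hmin⟩ := Finset.exists_min_image (Finset.univ.filter fun e => z e ≠ 0) τ
    ⟨e0, by simp [he0]⟩
  have he1' : z e1 ≠ 0 := (Finset.mem_filter.mp he1).2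
  have hτ0 : 0 ≤ τ e1 := by
    simp only [τ]
    split_ifs with h
    · exact div_nonneg (by linarith [(hx e1).2]) h.le
    · exact div_nonneg (hx e1).1 (by linarith [not_lt.mp h])
  refine ⟨x + τ e1 • z, ?_, ?_, ?_, e1, ?_, ?_⟩
  · intro e
    simp only [Pi.add_apply, Pi.smul_apply, smul_eq_mul]
    by_cases hze : z e = 0
    · simp [hze, hx e]
    · have hm := hmin e (by simp [hze])
      by_cases h : 0 < z e
      · have h2 : τ e = (1 - x e) / z e := by simp [τ, h]
        rw [h2, le_div_iff₀ h] at hm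
        have := mul_nonneg hτ0 h.le
        constructor <;> linarith [(hx e).1]
      · have h' : 0 < -z e := by
          have := lt_of_le_of_ne (not_lt.mp h) hze
          linarith
        have h2 : τ e = x e / (-z e) := by simp [τ, h]
        rw [h2, le_div_iff₀ h'] at hm
        have := mul_nonneg hτ0 h'.le
        constructor <;> linarith [(hx e).2]
  · rw [map_add, map_smul, hLz]; simp
  · intro e he
    simp [hzs e he]
  · intro h
    exact he1' (hzs e1 h)
  · simp only [Pi.add_apply, Pi.smul_apply, smul_eq_mul]
    by_cases h : 0 < z e1
    · right
      have h2 : τ e1 = (1 - x e1) / z e1 := by simp [τ, h]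
      rw [h2, div_mul_cancel₀ _ he1']
      ring
    · left
      have h2 : τ e1 = x e1 / (-z e1) := by simp [τ, h]
      rw [h2]
      field_simp
      ring

open Classical in
lemma round_move {E Z : Type*} [Fintype E] [AddCommGroup Z] [Module ℝ Z]
    (L : (E → ℝ) →ₗ[ℝ] Z) (c : ℕ) : ∀ (x : E → ℝ), (∀ e, 0 ≤ x e ∧ x e ≤ 1) →
    (Finset.univ.filter fun e => ¬ (x e = 0 ∨ x e = 1)).card ≤ c →
    ∃ x' : E → ℝ, (∀ e, 0 ≤ x' e ∧ x' e ≤ 1) ∧ L x' = L x ∧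
      (∀ e, (x e = 0 ∨ x e = 1) → x' e = x e) ∧
      ∀ z : E → ℝ, (∀ e, (x' e = 0 ∨ x' e = 1) → z e = 0) → L z = 0 → z = 0 := by
  induction c with
  | zero =>
    intro x hx hc
    refine ⟨x, hx, rfl, fun e _ => rfl, fun z hz _ => funext fun e => hz e ?_⟩
    by_contra h
    have : e ∈ Finset.univ.filter fun e => ¬ (x e = 0 ∨ x e = 1) := by simpa using h
    rw [Finset.card_eq_zero.mp (Nat.le_zero.mp hc)] at this
    simp at this
  | succ c ih =>
    intro x hx hc
    by_cases hex : ∀ z : E → ℝ, (∀ e, (x e = 0 ∨ x e = 1) → z e = 0) → L z = 0 → z = 0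
    · exact ⟨x, hx, rfl, fun e _ => rfl, hex⟩
    push Not at hex
    obtain ⟨z, hzs, hLz, hz⟩ := hex
    obtain ⟨y, hy, hLy, hyx, e, he, he'⟩ := round_step L x hx z hz hzs hLz
    obtain ⟨x', h1, h2, h3, h4⟩ := ih y hy (by
      apply Nat.le_of_lt_succ
      refine lt_of_lt_of_le (Finset.card_lt_card ?_) hc
      refine (Finset.ssubset_iff_of_subset ?_).mpr ⟨e, by rw [Finset.mem_filter]; exact ⟨Finset.mem_univ _, he⟩,
        by rw [Finset.mem_filter]; exact fun h => h.2 he'⟩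
      intro f hf
      simp only [Finset.mem_filter, Finset.mem_univ, true_and] at hf ⊢
      intro h
      apply hf
      rw [hyx f h]
      exact h)
    refine ⟨x', h1, h2.trans hLy, fun f hf => ?_, h4⟩
    have := hyx f hf
    rw [h3 f (by rw [this]; exact hf), this]

open Classical in
/-- If the sum over a finset of numbers in `[0,1]` is an integer, the number of fractional ones is
not one. -/
lemma two_le_frac {E : Type*} (S : Finset E) (x : E → ℝ) (hx : ∀ e, 0 ≤ x e ∧ x e ≤ 1)
    (d : ℤ) (hd : ∑ e ∈ S, x e = d) (e0 : E) (he0 : e0 ∈ S) (hf : ¬ (x e0 = 0 ∨ x e0 = 1)) :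
    2 ≤ (S.filter fun e => ¬ (x e = 0 ∨ x e = 1)).card := by
  by_contra hlt
  have hmem : e0 ∈ S.filter fun e => ¬ (x e = 0 ∨ x e = 1) := by
    rw [Finset.mem_filter]; exact ⟨he0, hf⟩
  have hle : (S.filter fun e => ¬ (x e = 0 ∨ x e = 1)).card ≤ 1 := by omega
  have hint : ∀ e ∈ S.erase e0, ∃ c : ℤ, x e = c := by
    intro e he
    by_cases h : x e = 0 ∨ x e = 1
    · rcases h with h | h
      · exact ⟨0, by simp [h]⟩
      · exact ⟨1, by simp [h]⟩
    · exfalso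
      have := Finset.card_le_one.mp hle e (by
        rw [Finset.mem_filter]; exact ⟨Finset.mem_of_mem_erase he, h⟩) e0 hmem
      exact Finset.ne_of_mem_erase he this
  choose! f hfi using hint
  rw [← Finset.add_sum_erase S x he0, Finset.sum_congr rfl hfi, ← Int.cast_sum] at hd
  have h1 : x e0 = ((d - ∑ e ∈ S.erase e0, f e : ℤ) : ℝ) := by
    push_cast at hd ⊢; linarith
  have h2 := hx e0
  rw [h1] at h2 hf
  have h3 : (0 : ℤ) ≤ d - ∑ e ∈ S.erase e0, f e := by exact_mod_cast h2.1
  have h4 : d - ∑ e ∈ S.erase e0, f e ≤ (1 : ℤ) := by exact_mod_cast h2.2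
  apply hf
  generalize d - ∑ e ∈ S.erase e0, f e = q at *
  rcases (by omega : q = 0 ∨ q = 1) with h | h
  · left; simp [h]
  · right; simp [h]

/-- degree map -/
noncomputable def degMap {E A : Type*} [Fintype E] [DecidableEq A] (l : E → A) :
    (E → ℝ) →ₗ[ℝ] (A → ℝ) where
  toFun x := fun a => ∑ e ∈ Finset.univ.filter (fun e => l e = a), x e
  map_add' x y := by ext a; simp [Finset.sum_add_distrib]
  map_smul' c x := by ext a; simp [Finset.mul_sum]

lemma card_le_of_kernel {E ι : Type*} [Fintype E] [Fintype ι] (F : Finset E)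
    (L : (E → ℝ) →ₗ[ℝ] (ι → ℝ))
    (h : ∀ z : E → ℝ, (∀ e, e ∉ F → z e = 0) → L z = 0 → z = 0) :
    F.card ≤ Fintype.card ι := by
  classical
  let ext : (F → ℝ) →ₗ[ℝ] (E → ℝ) :=
    { toFun := fun z e => if h : e ∈ F then z ⟨e, h⟩ else 0
      map_add' := by intro x y; ext e; by_cases h : e ∈ F <;> simp [h]
      map_smul' := by intro c y; ext e; by_cases h : e ∈ F <;> simp [h] }
  have hinj : Function.Injective (L ∘ₗ ext) := by
    rw [← LinearMap.ker_eq_bot, LinearMap.ker_eq_bot']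
    intro z hz
    have := h (ext z) (by intro e he; simp [ext, he]) hz
    ext e
    have h' := congrFun this e.1
    simpa [ext] using h'
  have := LinearMap.finrank_le_finrank_of_injective hinj
  simpa using this

lemma deg_zero_off {E A : Type*} [Fintype E] [DecidableEq A] (l : E → A) (F : Finset E) (z : E → ℝ)
    (hz : ∀ e, e ∉ F → z e = 0) (a : A) (ha : a ∉ F.image l) : degMap l z a = 0 := by
  apply Finset.sum_eq_zero
  intro e he
  apply hz
  intro hF
  exact ha (Finset.mem_image.mpr ⟨e, hF, (Finset.mem_filter.mp he).2⟩)

lemma side_bound {E A : Type*} [DecidableEq A] (F : Finset E) (K : ℝ) (l : E → A) (f : A → ℝ)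
    (hf : ∀ a, f a ≤ K) (hA : ∀ a ∈ F.image l, 2 ≤ (F.filter fun e => l e = a).card) :
    ∑ e ∈ F, f (l e) ≤ 2 * ∑ a ∈ F.image l, f a +
      ((F.card : ℝ) - 2 * (F.image l).card) * K := by
  have e1 : ∑ e ∈ F, f (l e) =
      ∑ a ∈ F.image l, ((F.filter fun e => l e = a).card : ℝ) * f a := by
    rw [← Finset.sum_fiberwise_of_maps_to (fun e he => Finset.mem_image_of_mem l he)]
    apply Finset.sum_congr rfl
    intro a _
    rw [Finset.sum_congr rfl (g := fun _ => f a), Finset.sum_const, nsmul_eq_mul]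
    intro e he
    rw [(Finset.mem_filter.mp he).2]
  have e2 : (F.card : ℝ) = ∑ a ∈ F.image l, ((F.filter fun e => l e = a).card : ℝ) := by
    rw [Finset.card_eq_sum_card_image l F]
    push_cast
    rfl
  have e3 : ((F.image l).card : ℝ) = ∑ a ∈ F.image l, (1 : ℝ) := by simp
  rw [e1, e2, e3, Finset.mul_sum, Finset.mul_sum, ← Finset.sum_sub_distrib, Finset.sum_mul,
    ← Finset.sum_add_distrib]
  apply Finset.sum_le_sum
  intro a ha
  have h2 : (2 : ℝ) ≤ ((F.filter fun e => l e = a).card : ℝ) := by exact_mod_cast hA a ha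
  nlinarith [hf a]

open Classical in
/-- General rounding theorem for bipartite multigraphs with extra linear constraints. -/
theorem rounding {E A B ι : Type*} [Fintype E] [Fintype ι] [Fintype A] [Fintype B]
    [DecidableEq A] [DecidableEq B]
    (l : E → A) (r : E → B) (x : E → ℝ) (hx : ∀ e, 0 ≤ x e ∧ x e ≤ 1)
    (dl : A → ℤ) (hdl : ∀ a, degMap l x a = dl a)
    (dr : B → ℤ) (hdr : ∀ b, degMap r x b = dr b)
    (φ : (E → ℝ) →ₗ[ℝ] (ι → ℝ)) :
    ∃ (y x' : E → ℝ) (F : Finset E), (∀ e, y e = 0 ∨ y e = 1) ∧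
      (∀ e, x e = 0 → y e = 0) ∧ (∀ e, x e = 0 → e ∉ F) ∧
      degMap l y = degMap l x ∧ degMap r y = degMap r x ∧ φ x' = φ x ∧
      (∀ e, e ∉ F → y e = x' e) ∧ (∀ e, |x' e - y e| ≤ 1) ∧
      ∀ (f : A → ℝ) (g : B → ℝ) (K : ℝ), (∀ a, f a ≤ K) → (∀ b, g b ≤ K) → 0 ≤ K →
        ∑ e ∈ F, (f (l e) + g (r e)) ≤
          2 * (∑ a ∈ F.image l, f a + ∑ b ∈ F.image r, g b) + 2 * Fintype.card ι * K := by
  -- first step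
  obtain ⟨x', hx', hL', hxx', hker'⟩ := round_move
    ((degMap l).prod ((degMap r).prod φ)) _ x hx le_rfl
  simp only [LinearMap.prod_apply, Function.prod_apply, Prod.mk.injEq] at hL'
  obtain ⟨hl', hr', hφ'⟩ := hL'
  obtain ⟨y, hy, hLy, hyx', hkery⟩ := round_move
    ((degMap l).prod (degMap r)) _ x' hx' le_rfl
  simp only [LinearMap.prod_apply, Function.prod_apply, Prod.mk.injEq] at hLy
  obtain ⟨hly, hry⟩ := hLy
  have hdeg2 : ∀ (x : E → ℝ), (∀ e, 0 ≤ x e ∧ x e ≤ 1) → (∀ a, degMap l x a = dl a) →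
      ∀ a ∈ (Finset.univ.filter fun e => ¬ (x e = 0 ∨ x e = 1)).image l,
      2 ≤ ((Finset.univ.filter fun e => ¬ (x e = 0 ∨ x e = 1)).filter fun e => l e = a).card := by
    intro x hx hd a ha
    obtain ⟨e0, he0, rfl⟩ := Finset.mem_image.mp ha
    have := two_le_frac (Finset.univ.filter fun e => l e = l e0) x hx (dl (l e0)) (hd _) e0
      (by simp) (Finset.mem_filter.mp he0).2
    rwa [Finset.filter_comm] at this
  have hdeg2r : ∀ (x : E → ℝ), (∀ e, 0 ≤ x e ∧ x e ≤ 1) → (∀ a, degMap r x a = dr a) →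
      ∀ a ∈ (Finset.univ.filter fun e => ¬ (x e = 0 ∨ x e = 1)).image r,
      2 ≤ ((Finset.univ.filter fun e => ¬ (x e = 0 ∨ x e = 1)).filter fun e => r e = a).card := by
    intro x hx hd a ha
    obtain ⟨e0, he0, rfl⟩ := Finset.mem_image.mp ha
    have := two_le_frac (Finset.univ.filter fun e => r e = r e0) x hx (dr (r e0)) (hd _) e0
      (by simp) (Finset.mem_filter.mp he0).2
    rwa [Finset.filter_comm] at this
  -- y is integral
  have hyint : ∀ e, y e = 0 ∨ y e = 1 := by
    by_contra hne
    push Not at hne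
    obtain ⟨e0, he0⟩ := hne
    set F := Finset.univ.filter fun e => ¬ (y e = 0 ∨ y e = 1) with hF
    have he0F : e0 ∈ F := by simp [hF, he0]
    have hA := hdeg2 y hy (by intro a; rw [hly, hl', hdl])
    have hB := hdeg2r y hy (by intro a; rw [hry, hr', hdr])
    rw [← hF] at hA hB
    have cA : 2 * (F.image l).card ≤ F.card := by
      rw [Finset.card_eq_sum_card_image l F, mul_comm, ← smul_eq_mul]
      exact Finset.card_nsmul_le_sum _ _ _ hA
    have cB : 2 * (F.image r).card ≤ F.card := by
      rw [Finset.card_eq_sum_card_image r F, mul_comm, ← smul_eq_mul]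
      exact Finset.card_nsmul_le_sum _ _ _ hB
    have hl0 : l e0 ∈ F.image l := Finset.mem_image_of_mem l he0F
    let L : (E → ℝ) →ₗ[ℝ] (((F.image l).erase (l e0)) ⊕ (F.image r) → ℝ) :=
      { toFun := fun z => Sum.elim (fun a => degMap l z a.1) (fun b => degMap r z b.1)
        map_add' := by intro z w; ext s; rcases s with s | s <;> simp
        map_smul' := by intro z w; ext s; rcases s with s | s <;> simp }
    have hc := card_le_of_kernel F L (by
      intro z hz hLz
      have k1 : ∀ b, degMap r z b = 0 := by
        intro b
        by_cases hb : b ∈ F.image r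
        · exact congrFun hLz (Sum.inr ⟨b, hb⟩)
        · exact deg_zero_off r F z hz b hb
      have k2 : ∀ a, a ≠ l e0 → degMap l z a = 0 := by
        intro a ha0
        by_cases ha : a ∈ F.image l
        · exact congrFun hLz (Sum.inl ⟨a, Finset.mem_erase.mpr ⟨ha0, ha⟩⟩)
        · exact deg_zero_off l F z hz a ha
      have k3 : ∑ a, degMap l z a = ∑ b, degMap r z b := by
        simp only [degMap, LinearMap.coe_mk, AddHom.coe_mk]
        rw [Finset.sum_fiberwise, Finset.sum_fiberwise]
      rw [Finset.sum_eq_zero (fun b _ => k1 b), Finset.sum_eq_single_of_mem (l e0)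
        (Finset.mem_univ _) (fun a _ ha => k2 a ha)] at k3
      apply hkery z
      · intro e he
        apply hz
        simp only [hF, Finset.mem_filter, Finset.mem_univ, true_and, not_not]
        exact he
      · simp only [LinearMap.prod_apply, Function.prod_apply, Prod.mk_eq_zero]
        refine ⟨funext fun a => ?_, funext k1⟩
        by_cases ha : a = l e0
        · rw [ha]; exact k3
        · exact k2 a ha)
    simp only [Fintype.card_sum, Fintype.card_coe, Finset.card_erase_of_mem hl0] at hc
    have : 0 < (F.image l).card := Finset.card_pos.mpr ⟨_, hl0⟩
    omega
  set F := Finset.univ.filter fun e => ¬ (x' e = 0 ∨ x' e = 1) with hF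
  have hA := hdeg2 x' hx' (by intro a; rw [hl', hdl])
  have hB := hdeg2r x' hx' (by intro a; rw [hr', hdr])
  rw [← hF] at hA hB
  refine ⟨y, x', F, hyint, ?_, ?_, hly.trans hl', hry.trans hr', hφ', ?_, ?_, ?_⟩
  · intro e he
    have h1 : x' e = 0 := by rw [hxx' e (Or.inl he), he]
    rw [hyx' e (Or.inl h1), h1]
  · intro e he
    have h1 : x' e = 0 := by rw [hxx' e (Or.inl he), he]
    simp [hF, h1]
  · intro e he
    apply hyx'
    simpa [hF, or_iff_not_imp_left] using he
  · intro e
    rw [abs_le]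
    constructor <;> linarith [(hx' e).1, (hx' e).2, (hy e).1, (hy e).2]
  · intro f g K hf hg hK
    let L : (E → ℝ) →ₗ[ℝ] ((F.image l) ⊕ (F.image r) ⊕ ι → ℝ) :=
      { toFun := fun z => Sum.elim (fun a => degMap l z a.1)
          (Sum.elim (fun b => degMap r z b.1) (φ z))
        map_add' := by intro z w; ext s; rcases s with s | s | s <;> simp
        map_smul' := by intro z w; ext s; rcases s with s | s | s <;> simp }
    have hc := card_le_of_kernel F L (by
      intro z hz hLz
      have k1 : ∀ b, degMap r z b = 0 := by
        intro b
        by_cases hb : b ∈ F.image r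
        · exact congrFun hLz (Sum.inr (Sum.inl ⟨b, hb⟩))
        · exact deg_zero_off r F z hz b hb
      have k2 : ∀ a, degMap l z a = 0 := by
        intro a
        by_cases ha : a ∈ F.image l
        · exact congrFun hLz (Sum.inl ⟨a, ha⟩)
        · exact deg_zero_off l F z hz a ha
      apply hker' z
      · intro e he
        apply hz
        simp only [hF, Finset.mem_filter, Finset.mem_univ, true_and, not_not]
        exact he
      · simp only [LinearMap.prod_apply, Function.prod_apply, Prod.mk_eq_zero]
        exact ⟨funext k2, funext k1, funext fun i => congrFun hLz (Sum.inr (Sum.inr i))⟩)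
    simp only [Fintype.card_sum, Fintype.card_coe] at hc
    have s1 := side_bound F K l f hf hA
    have s2 := side_bound F K r g hg hB
    rw [Finset.sum_add_distrib]
    have hcR : (F.card : ℝ) ≤ (F.image l).card + ((F.image r).card + Fintype.card ι) := by
      exact_mod_cast hc
    nlinarith

/-! ### Choosing the negative edges -/

/-- symmetrization of a weight on ordered pairs -/
def Amat {n : ℕ} (x : Fin n × Fin n → ℝ) : Matrix (Fin n) (Fin n) ℝ :=
  Matrix.of fun v w => x (v, w) + x (w, v)

lemma Amat_symm {n : ℕ} (x : Fin n × Fin n → ℝ) : (Amat x).IsSymm := by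
  ext v w
  simp [Amat, add_comm]

lemma degMap_left {k n : ℕ} (P : Fin n → Fin k) (x : Fin n × Fin n → ℝ) (v : Fin n) (j : Fin k) :
    degMap (fun e : Fin n × Fin n => (e.1, P e.2)) x (v, j) =
      ∑ w ∈ Finset.univ.filter (fun w => P w = j), x (v, w) := by
  simp only [degMap, LinearMap.coe_mk, AddHom.coe_mk]
  rw [Finset.sum_filter, Fintype.sum_prod_type, Finset.sum_eq_single v, Finset.sum_filter]
  · simp
  · intro v' _ hv'
    simp [hv']
  · simp

lemma degMap_right {k n : ℕ} (P : Fin n → Fin k) (x : Fin n × Fin n → ℝ) (v : Fin n) (j : Fin k) :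
    degMap (fun e : Fin n × Fin n => (e.2, P e.1)) x (v, j) =
      ∑ w ∈ Finset.univ.filter (fun w => P w = j), x (w, v) := by
  simp only [degMap, LinearMap.coe_mk, AddHom.coe_mk]
  rw [Finset.sum_filter, Fintype.sum_prod_type_right, Finset.sum_eq_single v, Finset.sum_filter]
  · simp
  · intro v' _ hv'
    simp [hv']
  · simp

lemma quad_Amat {n : ℕ} (x : Fin n × Fin n → ℝ) (u : Fin n → ℝ) :
    u ⬝ᵥ Amat x *ᵥ u = ∑ e, x e * (2 * (u e.1 * u e.2)) := by
  have h1 : u ⬝ᵥ Amat x *ᵥ u = ∑ v, ∑ w, x (v, w) * (u v * u w) +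
      ∑ v, ∑ w, x (w, v) * (u v * u w) := by
    simp only [dotProduct, Matrix.mulVec, Finset.mul_sum, Amat, Matrix.of_apply,
      ← Finset.sum_add_distrib]
    refine Finset.sum_congr rfl fun i _ => Finset.sum_congr rfl fun j _ => ?_
    ring
  have h2 : ∑ v, ∑ w, x (w, v) * (u v * u w) = ∑ v, ∑ w, x (v, w) * (u v * u w) := by
    rw [Finset.sum_comm]
    refine Finset.sum_congr rfl fun i _ => Finset.sum_congr rfl fun j _ => ?_
    ring
  rw [h1, h2, Fintype.sum_prod_type, ← Finset.sum_add_distrib]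
  refine Finset.sum_congr rfl fun i _ => ?_
  rw [← Finset.sum_add_distrib]
  refine Finset.sum_congr rfl fun j _ => ?_
  ring

lemma quad_expand {n : ℕ} (A : Matrix (Fin n) (Fin n) ℝ) (b : Fin n → (Fin n → ℝ))
    (S : Finset (Fin n)) (c : Fin n → ℝ) :
    (∑ i ∈ S, c i • b i) ⬝ᵥ A *ᵥ (∑ i ∈ S, c i • b i) =
      ∑ i ∈ S, ∑ j ∈ S, c i * (c j * (b i ⬝ᵥ A *ᵥ b j)) := by
  rw [Matrix.mulVec_sum, sum_dotProduct]
  refine Finset.sum_congr rfl fun i _ => ?_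
  rw [dotProduct_sum]
  refine Finset.sum_congr rfl fun j _ => ?_
  rw [Matrix.mulVec_smul, smul_dotProduct, dotProduct_smul, smul_eq_mul, smul_eq_mul]

/-- the linear functionals -/
def phiMap {n : ℕ} (b : Fin n → (Fin n → ℝ)) (S : Finset (Fin n)) :
    (Fin n × Fin n → ℝ) →ₗ[ℝ] (S × S → ℝ) where
  toFun x := fun p => b p.1 ⬝ᵥ Amat x *ᵥ b p.2
  map_add' x y := by
    ext p
    have : Amat (x + y) = Amat x + Amat y := by
      ext v w; simp [Amat]; ring
    rw [this, Matrix.add_mulVec, dotProduct_add]; rfl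
  map_smul' c x := by
    ext p
    have : Amat (c • x) = c • Amat x := by
      ext v w; simp [Amat]; ring
    rw [this, Matrix.smul_mulVec, dotProduct_smul]; rfl

lemma exists_y {k n : ℕ} [Nonempty (Fin k)] (P : Fin n → Fin k) (A : Matrix (Fin n) (Fin n) ℝ)
    (hA01 : ∀ v w, A v w = 0 ∨ A v w = 1) (hA : A.IsSymm) (hAP : ∀ v w, A v w = 1 → P v ≠ P w)
    (M D : Matrix (Fin k) (Fin k) ℝ) (hM : M.IsSymm) (hD : D.IsSymm)
    (hDint : ∀ i j, ∃ d : ℤ, D i j = d) (hD0 : ∀ i j, 0 ≤ D i j) (hDM : ∀ i j, D i j ≤ M i j)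
    (hDd : ∀ i, D i i = 0)
    (hrow : ∀ v j, ∑ w ∈ Finset.univ.filter (fun w => P w = j), A v w = M (P v) j)
    (β : ℝ) (b : Fin n → (Fin n → ℝ))
    (horth : ∀ i j, b i ⬝ᵥ b j = if i = j then (1 : ℝ) else 0)
    (S : Finset (Fin n)) (m : ℕ) (hm : 0 < m) (hS : S.card ≤ m)
    (hb : ∀ i ∈ S, ∀ x, |b i x| ≤ √((m : ℝ) / n)) (hn : m ^ 9 < n) (σ : ℝ)
    (hσ : σ = ∑ i, ∑ j, √(M i j)) :
    ∃ y : Fin n × Fin n → ℝ, (∀ e, y e = 0 ∨ y e = 1) ∧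
      (∀ v w, ¬ (A v w = 1 ∧ P v < P w) → y (v, w) = 0) ∧
      (∀ v j, ∑ w ∈ Finset.univ.filter (fun w => P w = j), Amat y v w = D (P v) j) ∧
      ∀ c : Fin n → ℝ, (∑ i ∈ S, c i • b i) ⬝ᵥ (β • A - Amat y) *ᵥ (∑ i ∈ S, c i • b i) ≤
        (lam (absMat (D - β • M)) 1 + 7 / 2 * σ) *
          ((∑ i ∈ S, c i • b i) ⬝ᵥ (∑ i ∈ S, c i • b i)) := by
  classical
  have hM0 : ∀ i j, 0 ≤ M i j := fun i j => (hD0 i j).trans (hDM i j)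
  have hMD : ∀ i j, M i j * (D i j / M i j) = D i j := by
    intro i j
    by_cases h : M i j = 0
    · have : D i j = 0 := le_antisymm (h ▸ hDM i j) (hD0 i j)
      simp [h, this]
    · field_simp
  set x0 : Fin n × Fin n → ℝ := fun e =>
    if P e.1 < P e.2 then A e.1 e.2 * (D (P e.1) (P e.2) / M (P e.1) (P e.2)) else 0 with hx0
  have hx01 : ∀ e, 0 ≤ x0 e ∧ x0 e ≤ 1 := by
    intro e
    have h1 : 0 ≤ D (P e.1) (P e.2) / M (P e.1) (P e.2) := div_nonneg (hD0 _ _) (hM0 _ _)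
    have h2 : D (P e.1) (P e.2) / M (P e.1) (P e.2) ≤ 1 := div_le_one_of_le₀ (hDM _ _) (hM0 _ _)
    simp only [hx0]
    split_ifs
    · rcases hA01 e.1 e.2 with h | h <;> rw [h] <;> simp [h1, h2]
    · simp
  have hL : ∀ v j, ∑ w ∈ Finset.univ.filter (fun w => P w = j), x0 (v, w) =
      if P v < j then D (P v) j else 0 := by
    intro v j
    have : ∀ w ∈ Finset.univ.filter (fun w => P w = j), x0 (v, w) =
        A v w * (if P v < j then D (P v) j / M (P v) j else 0) := by
      intro w hw
      have hw' := (Finset.mem_filter.mp hw).2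
      simp only [hx0, hw']
      split_ifs <;> simp
    rw [Finset.sum_congr rfl this, ← Finset.sum_mul, hrow]
    split_ifs
    · exact hMD _ _
    · simp
  have hR : ∀ v j, ∑ w ∈ Finset.univ.filter (fun w => P w = j), x0 (w, v) =
      if j < P v then D (P v) j else 0 := by
    intro v j
    have : ∀ w ∈ Finset.univ.filter (fun w => P w = j), x0 (w, v) =
        A v w * (if j < P v then D (P v) j / M (P v) j else 0) := by
      intro w hw
      have hw' := (Finset.mem_filter.mp hw).2
      simp only [hx0, hw']
      split_ifs
      · rw [hA.apply, hD.apply, hM.apply]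
      · simp
    rw [Finset.sum_congr rfl this, ← Finset.sum_mul, hrow]
    split_ifs
    · exact hMD _ _
    · simp
  choose d hd using hDint
  obtain ⟨y, x', F, hy01, hy0, hF0, hyl, hyr, hφ, hoff, hle, hbd⟩ := rounding
    (fun e : Fin n × Fin n => (e.1, P e.2)) (fun e : Fin n × Fin n => (e.2, P e.1)) x0 hx01
    (fun a => if P a.1 < a.2 then d (P a.1) a.2 else 0)
    (by
      rintro ⟨v, j⟩
      rw [degMap_left, hL]
      split_ifs <;> simp [hd])
    (fun a => if a.2 < P a.1 then d (P a.1) a.2 else 0)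
    (by
      rintro ⟨v, j⟩
      rw [degMap_right, hR]
      split_ifs <;> simp [hd])
    (phiMap b S)
  have hx00 : ∀ v w, ¬ (A v w = 1 ∧ P v < P w) → x0 (v, w) = 0 := by
    intro v w h
    simp only [hx0]
    split_ifs with h1
    · rcases hA01 v w with h2 | h2
      · rw [h2, zero_mul]
      · exact absurd ⟨h2, h1⟩ h
    · rfl
  have hFA : ∀ e ∈ F, A e.1 e.2 = 1 ∧ P e.1 < P e.2 := by
    intro e he
    by_contra h
    exact hF0 e (hx00 _ _ h) he
  have hAM : ∀ v w, A v w = 1 → 1 ≤ M (P v) (P w) := by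
    intro v w h
    rw [← hrow v (P w), ← h]
    apply Finset.single_le_sum (f := fun w => A v w)
    · intro i _
      rcases hA01 v i with h | h <;> simp [h]
    · simp
  have hA0 : ∀ v w, 0 ≤ A v w := by
    intro v w
    rcases hA01 v w with h | h <;> simp [h]
  refine ⟨y, hy01, fun v w h => hy0 _ (hx00 v w h), ?_, ?_⟩
  · intro v j
    simp only [Amat, Matrix.of_apply]
    rw [Finset.sum_add_distrib, ← degMap_left P y v j, ← degMap_right P y v j, hyl, hyr,
      degMap_left, degMap_right, hL, hR]
    rcases lt_trichotomy (P v) j with h | h | h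
    · simp [h, h.not_gt]
    · simp [h, hDd]
    · simp [h, h.not_gt]
  · intro c
    set u := ∑ i ∈ S, c i • b i with hu
    have huu : u ⬝ᵥ u = ∑ i ∈ S, c i ^ 2 := onb_norm b horth S c
    have huu0 : 0 ≤ u ⬝ᵥ u := dot_self_nonneg' u
    have hnpos : (0 : ℝ) < n := by
      have : 0 < n := by omega
      exact_mod_cast this
    -- pointwise bound
    have hK : ∀ v, u v ^ 2 ≤ (m : ℝ) ^ 2 / n * (u ⬝ᵥ u) := by
      intro v
      have h1 : u v = ∑ i ∈ S, c i * b i v := by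
        simp [hu, Finset.sum_apply]
      have h2 : ∑ i ∈ S, b i v ^ 2 ≤ (m : ℝ) ^ 2 / n := by
        calc ∑ i ∈ S, b i v ^ 2 ≤ ∑ i ∈ S, (m : ℝ) / n := by
              apply Finset.sum_le_sum
              intro i hi
              have h3 := hb i hi v
              have h4 : |b i v| ^ 2 ≤ (√((m : ℝ) / n)) ^ 2 :=
                pow_le_pow_left₀ (abs_nonneg _) h3 2
              rwa [sq_abs, Real.sq_sqrt (by positivity)] at h4
          _ = S.card * ((m : ℝ) / n) := by rw [Finset.sum_const, nsmul_eq_mul]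
          _ ≤ m * ((m : ℝ) / n) := by
              apply mul_le_mul_of_nonneg_right _ (by positivity)
              exact_mod_cast hS
          _ = _ := by ring
      rw [h1, huu, mul_comm]
      refine (Finset.sum_mul_sq_le_sq_mul_sq _ _ _).trans ?_
      exact mul_le_mul_of_nonneg_left h2 (Finset.sum_nonneg fun i _ => sq_nonneg _)
    -- part 1
    have hAx0 : ∀ v w, (β • A - Amat x0) v w =
        A v w * (β - D (P v) (P w) / M (P v) (P w)) := by
      intro v w
      simp only [Amat, Matrix.sub_apply, Matrix.smul_apply, Matrix.of_apply, smul_eq_mul, hx0]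
      rcases lt_trichotomy (P v) (P w) with h | h | h
      · simp [h, h.not_gt]; ring
      · have : A v w = 0 := by
          rcases hA01 v w with h1 | h1
          · exact h1
          · exact absurd h (hAP v w h1)
        simp [h, this]
      · simp only [h, h.not_gt, if_true, if_false]
        rw [hA.apply, hD.apply, hM.apply]; ring
    have p1 : u ⬝ᵥ (β • A - Amat x0) *ᵥ u ≤ lam (absMat (D - β • M)) 1 * (u ⬝ᵥ u) := by
      have := block_bilin P (β • A - Amat x0) ((hA.smul β).sub (Amat_symm x0))
        (absMat (D - β • M))
        (by
          ext i j
          simp only [absMat, Matrix.transpose_apply, Matrix.of_apply, Matrix.sub_apply,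
            Matrix.smul_apply]
          rw [hD.apply, hM.apply])
        (by intro i j; simp [absMat])
        (by
          intro v j
          have : ∀ w ∈ Finset.univ.filter (fun w => P w = j), |(β • A - Amat x0) v w| =
              A v w * |β - D (P v) j / M (P v) j| := by
            intro w hw
            rw [hAx0, (Finset.mem_filter.mp hw).2, abs_mul, abs_of_nonneg (hA0 v w)]
          rw [Finset.sum_congr rfl this, ← Finset.sum_mul, hrow]
          simp only [absMat, Matrix.of_apply, Matrix.sub_apply, Matrix.smul_apply, smul_eq_mul]
          nth_rewrite 1 [← abs_of_nonneg (hM0 (P v) j)]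
          rw [← abs_mul, mul_sub, hMD, abs_sub_comm, mul_comm β])
        u u
      rwa [Real.mul_self_sqrt huu0] at this
    -- part 2
    have p2 : u ⬝ᵥ Amat x' *ᵥ u = u ⬝ᵥ Amat x0 *ᵥ u := by
      rw [hu, quad_expand, quad_expand]
      refine Finset.sum_congr rfl fun i hi => Finset.sum_congr rfl fun j hj => ?_
      have : b i ⬝ᵥ Amat x' *ᵥ b j = b i ⬝ᵥ Amat x0 *ᵥ b j :=
        congrFun hφ (⟨i, hi⟩, ⟨j, hj⟩)
      rw [this]
    -- part 3
    have p3 : u ⬝ᵥ Amat x' *ᵥ u - u ⬝ᵥ Amat y *ᵥ u ≤ ∑ e ∈ F, (u e.1 ^ 2 + u e.2 ^ 2) := by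
      rw [quad_Amat, quad_Amat, ← Finset.sum_sub_distrib,
        ← Finset.sum_subset (Finset.subset_univ F)]
      · apply Finset.sum_le_sum
        intro e _
        have h1 : x' e * (2 * (u e.1 * u e.2)) - y e * (2 * (u e.1 * u e.2)) =
            (x' e - y e) * (2 * (u e.1 * u e.2)) := by ring
        rw [h1]
        have h2 := abs_le.mp (hle e)
        have h3 : |(x' e - y e) * (2 * (u e.1 * u e.2))| ≤ 1 * |2 * (u e.1 * u e.2)| := by
          rw [abs_mul]
          exact mul_le_mul_of_nonneg_right (hle e) (abs_nonneg _)
        have h4 : |2 * (u e.1 * u e.2)| ≤ u e.1 ^ 2 + u e.2 ^ 2 := by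
          rw [abs_le]
          constructor <;> nlinarith [sq_nonneg (u e.1 - u e.2), sq_nonneg (u e.1 + u e.2)]
        linarith [le_abs_self ((x' e - y e) * (2 * (u e.1 * u e.2)))]
      · intro e _ he
        rw [hoff e he, sub_self]
    have hσ0 : 0 ≤ σ := by
      rw [hσ]
      exact Finset.sum_nonneg fun i _ => Finset.sum_nonneg fun j _ => Real.sqrt_nonneg _
    have hrowσ : ∀ i, ∑ j, √(M i j) ≤ σ := by
      intro i
      rw [hσ]
      exact Finset.single_le_sum (f := fun i => ∑ j, √(M i j))
        (fun i _ => Finset.sum_nonneg fun j _ => Real.sqrt_nonneg _) (Finset.mem_univ i)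
    have p4 : ∑ e ∈ F, (u e.1 ^ 2 + u e.2 ^ 2) ≤ 3 * σ * (u ⬝ᵥ u) := by
      rcases F.eq_empty_or_nonempty with hFe | ⟨e0, he0⟩
      · rw [hFe, Finset.sum_empty]; positivity
      have hσ1 : 1 ≤ σ := by
        have h1 : 1 ≤ √(M (P e0.1) (P e0.2)) := by
          rw [Real.one_le_sqrt]
          exact hAM _ _ (hFA e0 he0).1
        refine h1.trans (le_trans ?_ (hrowσ (P e0.1)))
        exact Finset.single_le_sum (f := fun j => √(M (P e0.1) j))
          (fun j _ => Real.sqrt_nonneg _) (Finset.mem_univ _)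
      have h1 := hbd (fun a => u a.1 ^ 2) (fun a => u a.1 ^ 2) ((m : ℝ) ^ 2 / n * (u ⬝ᵥ u))
        (fun a => hK a.1) (fun a => hK a.1) (by positivity)
      refine h1.trans ?_
      have hcard : (Fintype.card (S × S) : ℝ) ≤ (m : ℝ) ^ 2 := by
        rw [Fintype.card_prod, Fintype.card_coe]
        have : S.card * S.card ≤ m ^ 2 := by nlinarith
        exact_mod_cast this
      have hmn : 2 * (m : ℝ) ^ 4 ≤ n := by
        have : 2 * m ^ 4 ≤ n := by
          rcases Nat.lt_or_ge m 2 with h | h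
          · have : m = 1 := by omega
            subst this
            simp at hn ⊢
            omega
          · have h5 : 2 ≤ m ^ 5 := le_trans h (Nat.le_self_pow (by norm_num) m)
            have : m ^ 9 = m ^ 5 * m ^ 4 := by ring
            nlinarith [Nat.zero_le (m ^ 4)]
        exact_mod_cast this
      have hlast : 2 * (Fintype.card (S × S) : ℝ) * ((m : ℝ) ^ 2 / n * (u ⬝ᵥ u)) ≤ u ⬝ᵥ u := by
        calc 2 * (Fintype.card (S × S) : ℝ) * ((m : ℝ) ^ 2 / n * (u ⬝ᵥ u))
            ≤ 2 * (m : ℝ) ^ 2 * ((m : ℝ) ^ 2 / n * (u ⬝ᵥ u)) := by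
              apply mul_le_mul_of_nonneg_right _ (by positivity)
              linarith
          _ = (2 * (m : ℝ) ^ 4 / n) * (u ⬝ᵥ u) := by ring
          _ ≤ 1 * (u ⬝ᵥ u) := by
              apply mul_le_mul_of_nonneg_right _ huu0
              rw [div_le_one hnpos]
              exact hmn
          _ = _ := one_mul _
      have hmid : ∑ a ∈ F.image (fun e : Fin n × Fin n => (e.1, P e.2)), u a.1 ^ 2 +
          ∑ a ∈ F.image (fun e : Fin n × Fin n => (e.2, P e.1)), u a.1 ^ 2 ≤ σ * (u ⬝ᵥ u) := by
        rw [← Finset.sum_union]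
        · calc _ ≤ ∑ a ∈ F.image (fun e : Fin n × Fin n => (e.1, P e.2)) ∪
                F.image (fun e : Fin n × Fin n => (e.2, P e.1)), u a.1 ^ 2 * √(M (P a.1) a.2) := by
                apply Finset.sum_le_sum
                intro a ha
                have : 1 ≤ √(M (P a.1) a.2) := by
                  rw [Real.one_le_sqrt]
                  rcases Finset.mem_union.mp ha with h | h
                  · obtain ⟨e, he, rfl⟩ := Finset.mem_image.mp h
                    exact hAM _ _ (hFA e he).1
                  · obtain ⟨e, he, rfl⟩ := Finset.mem_image.mp h
                    refine hAM _ _ ?_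
                    rw [hA.apply]
                    exact (hFA e he).1
                nlinarith [sq_nonneg (u a.1)]
            _ ≤ ∑ a : Fin n × Fin k, u a.1 ^ 2 * √(M (P a.1) a.2) := by
                apply Finset.sum_le_sum_of_subset_of_nonneg (Finset.subset_univ _)
                intro a _ _
                positivity
            _ ≤ _ := by
                rw [Fintype.sum_prod_type, dotProduct, Finset.mul_sum]
                apply Finset.sum_le_sum
                intro v _
                simp only
                rw [← Finset.mul_sum]
                have := hrowσ (P v)
                nlinarith [sq_nonneg (u v)]
        · rw [Finset.disjoint_left]
          intro a h1 h2
          obtain ⟨e, he, rfl⟩ := Finset.mem_image.mp h1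
          obtain ⟨e', he', h3⟩ := Finset.mem_image.mp h2
          simp only [Prod.mk.injEq] at h3
          have h4 := (hFA e he).2
          have h5 := (hFA e' he').2
          rw [h3.1, h3.2] at h5
          exact absurd h4 h5.not_gt
      nlinarith
    have e1 : u ⬝ᵥ (β • A - Amat y) *ᵥ u = u ⬝ᵥ (β • A - Amat x0) *ᵥ u +
        (u ⬝ᵥ Amat x' *ᵥ u - u ⬝ᵥ Amat y *ᵥ u) := by
      rw [p2]
      simp only [Matrix.sub_mulVec, dotProduct_sub]
      ring
    rw [e1]
    nlinarith

/-- the orthonormal eigenbasis of `A_G` is given by the family `b` with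
eigenvalues `μ`; the sub-family indexed by `T` is a basis for the vectors constant on each
part; every eigenvector with eigenvalue exceeding `σ` has all entries at most `√(m/n)`;
and at most `m` of the eigenvalues exceed `σ`.  Conclusion: there is an `M'`-signing `s` of
`G` with `λ₁(A_s) = λ₁(M')`. -/
theorem stmt_13 {k n : ℕ} (M : Matrix (Fin k) (Fin k) ℕ) (M' : Matrix (Fin k) (Fin k) ℤ)
    (β : ℝ) (hM : MemM M M' β)
    (G : SimpleGraph (Fin n)) (P : Fin n → Fin k) (hlift : IsGraphLift M G P)
    (m : ℕ) (hm : 0 < m)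
    (hlam2 : lam (adjMat G) 2 ≤ lam (intToReal M') 1)
    (b : Fin n → (Fin n → ℝ)) (μ : Fin n → ℝ)
    (heig : ∀ i, (adjMat G).mulVec (b i) = μ i • b i)
    (horth : ∀ i j, b i ⬝ᵥ b j = if i = j then (1 : ℝ) else 0)
    (hcount : (Finset.univ.filter fun i => sigmaM M < μ i).card ≤ m)
    (T : Finset (Fin n))
    (hbasis : Submodule.span ℝ (b '' ↑T) = constOnParts P)
    (hentry : ∀ i, sigmaM M < μ i → ∀ x, |b i x| ≤ Real.sqrt ((m : ℝ) / n))
    (hn : m ^ 9 < n) :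
    ∃ s : Fin n → Fin n → ℤ, IsMSigning M' G P s ∧
      lam (signAdj G s) 1 = lam (intToReal M') 1 := by
  have hnpos : 0 < n := by omega
  have : Nonempty (Fin n) := ⟨⟨0, hnpos⟩⟩
  have : Nonempty (Fin k) := ⟨P ⟨0, hnpos⟩⟩
  set A := adjMat G with hAdef
  set Mr := natToReal M with hMr
  set Mr' := intToReal M' with hMr'
  set D := DMat M M' with hDdef
  set σ := sigmaM M with hσdef
  have hAv : ∀ v w, A v w = 1 ∧ G.Adj v w ∨ A v w = 0 ∧ ¬ G.Adj v w := by
    intro v w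
    simp only [hAdef, adjMat, SimpleGraph.adjMatrix_apply]
    by_cases h : G.Adj v w <;> simp [h]
  have hA01 : ∀ v w, A v w = 0 ∨ A v w = 1 := fun v w => by
    rcases hAv v w with h | h
    · exact Or.inr h.1
    · exact Or.inl h.1
  have hAadj : ∀ v w, A v w = 1 ↔ G.Adj v w := fun v w => by
    rcases hAv v w with h | h
    · simp [h.1, h.2]
    · simp [h.1, h.2]
  have hA0 : ∀ v w, 0 ≤ A v w := by
    intro v w
    rcases hA01 v w with h | h <;> simp [h]
  have hA : A.IsSymm := by
    ext v w
    rw [Matrix.transpose_apply]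
    rcases hAv v w with h | h
    · rw [h.1]; exact (hAadj w v).mpr h.2.symm
    · rw [h.1]
      rcases hAv w v with h' | h'
      · exact absurd h'.2.symm h.2
      · exact h'.1
  have hAP : ∀ v w, A v w = 1 → P v ≠ P w := fun v w h =>
    hlift.not_adj_within v w ((hAadj v w).mp h)
  have hMs : Mr.IsSymm := by
    ext i j
    simp only [hMr, natToReal, Matrix.transpose_apply, Matrix.of_apply]
    rw [hM.symm.apply]
  have hM's : Mr'.IsSymm := by
    ext i j
    simp only [hMr', intToReal, Matrix.transpose_apply, Matrix.of_apply]
    rw [hM.signMatrix.1.apply]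
  have hDe : ∀ i j, D i j = ((M i j : ℝ) - (M' i j : ℝ)) / 2 := by
    intro i j
    simp only [hDdef, DMat, natToReal, intToReal, Matrix.smul_apply, Matrix.sub_apply,
      Matrix.of_apply, smul_eq_mul]
    ring
  have hDs : D.IsSymm := by
    ext i j
    rw [Matrix.transpose_apply, hDe, hDe, hM.symm.apply, hM.signMatrix.1.apply]
  have habs : ∀ i j, |(M' i j : ℝ)| ≤ (M i j : ℝ) := by
    intro i j
    have := (hM.signMatrix.2 i j).2
    exact_mod_cast this
  have hD0 : ∀ i j, 0 ≤ D i j := by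
    intro i j
    rw [hDe]
    linarith [(abs_le.mp (habs i j)).2]
  have hDM : ∀ i j, D i j ≤ Mr i j := by
    intro i j
    rw [hDe]
    simp only [hMr, natToReal, Matrix.of_apply]
    linarith [(abs_le.mp (habs i j)).1]
  have hDint : ∀ i j, ∃ d : ℤ, D i j = d := by
    intro i j
    obtain ⟨c, hc⟩ := (hM.signMatrix.2 i j).1
    refine ⟨-c, ?_⟩
    rw [hDe]
    have : (M' i j : ℝ) - (M i j : ℝ) = 2 * c := by exact_mod_cast hc
    push_cast
    linarith
  have hDd : ∀ i, D i i = 0 := by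
    intro i
    have h1 : Mr i i = 0 := by simp [hMr, natToReal, hM.diag]
    exact le_antisymm (h1 ▸ hDM i i) (hD0 i i)
  have hM'e : ∀ i j, Mr' i j = Mr i j - 2 * D i j := by
    intro i j
    rw [hDe]
    simp only [hMr, hMr', natToReal, intToReal, Matrix.of_apply]
    ring
  have hrow : ∀ v j, ∑ w ∈ Finset.univ.filter (fun w => P w = j), A v w = Mr (P v) j := by
    classical
    intro v j
    by_cases hj : j = P v
    · subst hj
      have h1 : Mr (P v) (P v) = 0 := by simp [hMr, natToReal, hM.diag]
      rw [h1]
      apply Finset.sum_eq_zero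
      intro w hw
      rcases hA01 v w with h | h
      · exact h
      · exact absurd (Finset.mem_filter.mp hw).2.symm (hAP v w h)
    · have h1 := hlift.between_regular v j hj
      have h2 : {w : Fin n | G.Adj v w ∧ P w = j} =
          ↑((Finset.univ.filter (fun w => P w = j)).filter (fun w => G.Adj v w)) := by
        ext w; simp [and_comm]
      rw [h2, Set.ncard_coe_finset] at h1
      have h3 : Mr (P v) j = (M (P v) j : ℝ) := rfl
      rw [h3, ← h1, Finset.card_filter]
      push_cast
      refine Finset.sum_congr rfl fun w _ => ?_
      rcases hAv v w with h | h <;> simp [h.1, h.2]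
  have hσ : σ = ∑ i, ∑ j, √(Mr i j) := rfl
  set S := Finset.univ.filter (fun i => σ < μ i ∧ i ∉ T) with hS
  obtain ⟨y, hy01, hy0, hyrow, hyq⟩ := exists_y P A hA01 hA hAP Mr D hMs hDs hDint hD0 hDM hDd hrow
    β b horth S m hm
    (by
      refine (Finset.card_le_card ?_).trans hcount
      intro i hi
      simp only [hS, Finset.mem_filter, Finset.mem_univ, true_and] at hi ⊢
      exact hi.1)
    (by
      intro i hi
      exact hentry i (by simpa using ((Finset.mem_filter.mp hi).2).1)) hn σ hσ
  -- the signing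
  set s : Fin n → Fin n → ℤ := fun v w => if Amat y v w = 1 then -1 else 1 with hs
  have hyA : ∀ v w, A v w = 1 → Amat y v w = 0 ∨ Amat y v w = 1 := by
    intro v w h
    simp only [Amat, Matrix.of_apply]
    rcases lt_or_gt_of_ne (hAP v w h) with h1 | h1
    · rw [hy0 w v (fun h' => absurd h1 h'.2.not_gt), add_zero]
      exact hy01 _
    · rw [hy0 v w (fun h' => absurd h1 h'.2.not_gt), zero_add]
      exact hy01 _
  have hAs : signAdj G s = A - (2 : ℝ) • Amat y := by
    ext v w
    simp only [signAdj, Matrix.of_apply, Matrix.sub_apply, Matrix.smul_apply, smul_eq_mul]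
    rcases hAv v w with h | h
    · rw [if_pos h.2, h.1]
      rcases hyA v w h.1 with h1 | h1
      · simp [hs, h1]
      · simp [hs, h1]; norm_num
    · rw [if_neg h.2, h.1]
      have h2 : A w v = 0 := by rw [hA.apply]; exact h.1
      have h3 : Amat y v w = 0 := by
        simp only [Amat, Matrix.of_apply]
        rw [hy0 v w (by rw [h.1]; simp), hy0 w v (by rw [h2]; simp), add_zero]
      simp [h3]
  set As := signAdj G s with hAsdef
  have hAss : As.IsSymm := by
    rw [hAs]
    exact hA.sub ((Amat_symm y).smul 2)
  have hAsrow : ∀ v j, ∑ w ∈ Finset.univ.filter (fun w => P w = j), As v w = Mr' (P v) j := by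
    intro v j
    rw [hAs, hM'e, ← hrow, ← hyrow, Finset.mul_sum, ← Finset.sum_sub_distrib]
    rfl
  refine ⟨s, ⟨?_, ?_, ?_⟩, ?_⟩
  · intro v w
    simp only [hs]
    rw [(Amat_symm y).apply]
  · intro v w _
    simp only [hs]
    split_ifs <;> simp
  · classical
    intro v j hj
    have h1 := hAsrow v j
    have h2 : Mr' (P v) j = ((M' (P v) j : ℤ) : ℝ) := rfl
    rw [h2] at h1
    have h3 : ((∑ w : Fin n, {w' : Fin n | G.Adj v w' ∧ P w' = j}.indicator (s v) w : ℤ) : ℝ) =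
        ∑ w ∈ Finset.univ.filter (fun w => P w = j), As v w := by
      push_cast
      rw [Finset.sum_filter]
      refine Finset.sum_congr rfl fun w _ => ?_
      simp only [hAsdef, signAdj, Matrix.of_apply, Set.indicator, Set.mem_setOf_eq]
      by_cases h4 : P w = j <;> by_cases h5 : G.Adj v w <;> simp [h4, h5]
    rw [h1] at h3
    exact_mod_cast h3
  -- the eigenvalue
  apply le_antisymm
  swap
  · obtain ⟨p, hp, hp'⟩ := lam_eigvec Mr' hM's
    have h1 := lift_mulVec P As Mr' hAsrow p
    rw [hp'] at h1
    have h2 : (lam Mr' 1 • p) ∘ P = lam Mr' 1 • (p ∘ P) := rfl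
    rw [h2] at h1
    have h3 := rayleigh As hAss (p ∘ P)
    rw [h1, dotProduct_smul, smul_eq_mul] at h3
    have h4 : 0 < (p ∘ P) ⬝ᵥ (p ∘ P) := by
      refine lt_of_le_of_ne (dot_self_nonneg' _) fun h => ?_
      rw [eq_comm, dotProduct_self_eq_zero] at h
      have : p = 0 := by
        ext i
        obtain ⟨v, rfl⟩ := hlift.parts_cover i
        exact congrFun h v
      rw [this] at hp
      simp at hp
    exact le_of_mul_le_mul_right h3 h4
  -- eigenvalues outside T
  have hconst : ∀ f : Fin n → ℝ, f ∈ constOnParts P → ∃ p : Fin k → ℝ, f = p ∘ P := by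
    intro f hf
    choose g hg using hlift.parts_cover
    exact ⟨f ∘ g, funext fun v => hf _ _ (hg (P v)).symm⟩
  have hconst' : ∀ p : Fin k → ℝ, p ∘ P ∈ constOnParts P := by
    intro p x y h
    simp [Function.comp, h]
  have hTorth : ∀ f ∈ constOnParts P, ∀ i, i ∉ T → f ⬝ᵥ b i = 0 := by
    intro f hf i hi
    rw [← hbasis] at hf
    induction hf using Submodule.span_induction with
    | mem x hx =>
      obtain ⟨j, hj, rfl⟩ := hx
      rw [horth, if_neg]
      rintro rfl
      exact hi hj
    | zero => simp
    | add x y _ _ hx hy => rw [add_dotProduct, hx, hy, add_zero]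
    | smul c x _ hx => rw [smul_dotProduct, hx, smul_zero]
  have hμ : ∀ i, i ∉ T → μ i ≤ lam Mr' 1 := by
    intro i hi
    refine le_trans ?_ hlam2
    have h1 : μ i ≤ lam Mr 1 := by
      have := block_bilin P A hA Mr hMs (fun i j => (hD0 i j).trans (hDM i j))
        (by
          intro v j
          rw [← hrow]
          exact le_of_eq (Finset.sum_congr rfl fun w _ => abs_of_nonneg (hA0 v w))) (b i) (b i)
      rw [Real.mul_self_sqrt (dot_self_nonneg' _), heig, dotProduct_smul, horth, if_pos rfl] at this
      simpa using this
    obtain ⟨p, hp, hp'⟩ := lam_eigvec Mr hMs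
    have h2 := lift_mulVec P A Mr hrow p
    rw [hp'] at h2
    have h2' : (lam Mr 1 • p) ∘ P = lam Mr 1 • (p ∘ P) := rfl
    rw [h2'] at h2
    have h4 : p ∘ P ≠ 0 := by
      intro h
      have : p = 0 := by
        ext i
        obtain ⟨v, rfl⟩ := hlift.parts_cover i
        exact congrFun h v
      rw [this] at hp
      simp at hp
    obtain ⟨j, hj⟩ : ∃ j, b j ⬝ᵥ (p ∘ P) ≠ 0 := by
      by_contra hcon
      push Not at hcon
      apply h4
      rw [onb_expand b horth (p ∘ P)]
      exact Finset.sum_eq_zero fun j _ => by rw [hcon j, zero_smul]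
    have hjT : j ∈ T := by
      by_contra hjT
      apply hj
      rw [dotProduct_comm]
      exact hTorth _ (hconst' p) j hjT
    have h5 : lam Mr 1 = μ j := by
      have h6 := symm_dot A hA (b j) (p ∘ P)
      rw [h2, heig, dotProduct_smul, dotProduct_smul, dotProduct_comm (p ∘ P)] at h6
      exact mul_right_cancel₀ hj h6
    exact le_lam_two A b μ heig horth i j (fun h => hi (h ▸ hjT)) (μ i) le_rfl (h5 ▸ h1)
  apply lam_le As hAss
  intro x
  set c : Fin n → ℝ := fun i => b i ⬝ᵥ x with hc
  have hx := onb_expand b horth x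
  set S' := Finset.univ.filter (fun i => ¬ σ < μ i ∧ i ∉ T) with hS'
  set q := ∑ i ∈ T, c i • b i with hq
  set u := ∑ i ∈ S, c i • b i with hu
  set w := ∑ i ∈ S', c i • b i with hw
  have hdSS' : Disjoint S S' := by
    rw [Finset.disjoint_left]
    intro i h1 h2
    exact (Finset.mem_filter.mp h2).2.1 (Finset.mem_filter.mp h1).2.1
  have hdTS : Disjoint T S := by
    rw [Finset.disjoint_left]
    intro i h1 h2
    exact (Finset.mem_filter.mp h2).2.2 h1
  have hdTS' : Disjoint T S' := by
    rw [Finset.disjoint_left]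
    intro i h1 h2
    exact (Finset.mem_filter.mp h2).2.2 h1
  have hdec : x = q + (u + w) := by
    conv_lhs => rw [hx]
    rw [hu, hw, ← Finset.sum_union hdSS', hq, ← Finset.sum_union]
    · refine Finset.sum_congr ?_ fun i _ => rfl
      ext i
      simp only [hS, hS', Finset.mem_union, Finset.mem_filter, Finset.mem_univ, true_and,
        true_iff]
      tauto
    · rw [Finset.disjoint_union_right]
      exact ⟨hdTS, hdTS'⟩
  have oqu : q ⬝ᵥ u = 0 := onb_disj b horth T S hdTS c c
  have oqw : q ⬝ᵥ w = 0 := onb_disj b horth T S' hdTS' c c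
  have ouw : u ⬝ᵥ w = 0 := onb_disj b horth S S' hdSS' c c
  have hqc : q ∈ constOnParts P := by
    rw [← hbasis]
    exact Submodule.sum_mem _ fun i hi =>
      Submodule.smul_mem _ _ (Submodule.subset_span ⟨i, hi, rfl⟩)
  have hcu : ∀ f ∈ constOnParts P, f ⬝ᵥ (u + w) = 0 := by
    intro f hf
    rw [dotProduct_add, hu, hw, dotProduct_sum, dotProduct_sum, Finset.sum_eq_zero,
      Finset.sum_eq_zero, add_zero]
    · intro i hi
      rw [dotProduct_smul, hTorth f hf i (Finset.mem_filter.mp hi).2.2, smul_zero]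
    · intro i hi
      rw [dotProduct_smul, hTorth f hf i (Finset.mem_filter.mp hi).2.2, smul_zero]
  obtain ⟨p, hp⟩ := hconst q hqc
  have hcross : (u + w) ⬝ᵥ As *ᵥ q = 0 := by
    rw [hp, lift_mulVec P As Mr' hAsrow p, dotProduct_comm]
    exact hcu _ (hconst' _)
  have hqq : q ⬝ᵥ As *ᵥ q ≤ lam Mr' 1 * (q ⬝ᵥ q) := by
    rw [hp]
    exact lift_quad P As hAss Mr' hM's hAsrow p
  have hcross' := symm_dot As hAss (u + w) q
  -- quadratic forms
  set nu := √(u ⬝ᵥ u) with hnu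
  set nw := √(w ⬝ᵥ w) with hnw
  have nu2 : nu * nu = u ⬝ᵥ u := Real.mul_self_sqrt (dot_self_nonneg' _)
  have nw2 : nw * nw = w ⬝ᵥ w := Real.mul_self_sqrt (dot_self_nonneg' _)
  have hDbl : ∀ x z : Fin n → ℝ, x ⬝ᵥ Amat y *ᵥ z ≤ lam D 1 * (√(x ⬝ᵥ x) * √(z ⬝ᵥ z)) := by
    intro x z
    apply block_bilin P (Amat y) (Amat_symm y) D hDs hD0
    intro v j
    rw [← hyrow]
    refine le_of_eq (Finset.sum_congr rfl fun w _ => abs_of_nonneg ?_)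
    simp only [Amat, Matrix.of_apply]
    have h1 : ∀ e, 0 ≤ y e := fun e => by rcases hy01 e with h | h <;> simp [h]
    exact add_nonneg (h1 _) (h1 _)
  have hAu : u ⬝ᵥ A *ᵥ u ≤ lam Mr' 1 * (u ⬝ᵥ u) := by
    rw [hu, onb_quad A b μ heig horth, onb_norm b horth, Finset.mul_sum]
    refine Finset.sum_le_sum fun i hi => mul_le_mul_of_nonneg_right ?_ (sq_nonneg _)
    exact hμ i (Finset.mem_filter.mp hi).2.2
  have hAw : w ⬝ᵥ A *ᵥ w ≤ σ * (w ⬝ᵥ w) := by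
    rw [hw, onb_quad A b μ heig horth, onb_norm b horth, Finset.mul_sum]
    refine Finset.sum_le_sum fun i hi => mul_le_mul_of_nonneg_right ?_ (sq_nonneg _)
    exact not_lt.mp (Finset.mem_filter.mp hi).2.1
  have hAuw : u ⬝ᵥ A *ᵥ w = 0 := by
    have : A *ᵥ w = ∑ i ∈ S', (c i * μ i) • b i := by
      rw [hw, Matrix.mulVec_sum]
      refine Finset.sum_congr rfl fun i _ => ?_
      rw [Matrix.mulVec_smul, heig, smul_smul]
    rw [this]
    exact onb_disj b horth S S' hdSS' c (fun i => c i * μ i)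
  have hYu := hyq c
  rw [← hu] at hYu
  rw [Matrix.sub_mulVec, dotProduct_sub, Matrix.smul_mulVec, dotProduct_smul, smul_eq_mul] at hYu
  have hYw := hDbl (-w) w
  have hYuw := hDbl (-u) w
  rw [neg_dotProduct_neg, neg_dotProduct, ← hnw, nw2] at hYw
  rw [neg_dotProduct_neg, neg_dotProduct, ← hnw, ← hnu] at hYuw
  -- 2x2 matrix
  have h22 : ∀ a d e : ℝ, a * (nu * nu) + 2 * d * (nu * nw) + e * (nw * nw) ≤
      lam !![a, d; d, e] 1 * (nu * nu + nw * nw) := by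
    intro a d e
    have := rayleigh !![a, d; d, e] (by
      ext i j
      fin_cases i <;> fin_cases j <;> rfl) ![nu, nw]
    simp only [Matrix.mulVec, dotProduct, Fin.sum_univ_two, Matrix.of_apply, Matrix.cons_val_zero,
      Matrix.cons_val_one] at this
    linarith
  have h22' := h22 _ _ _ |>.trans (mul_le_mul_of_nonneg_right hM.eig_cond
    (add_nonneg (mul_self_nonneg nu) (mul_self_nonneg nw)))
  rw [nu2, nw2] at h22'
  have hβ := hM.beta_mem
  have hAu' : (1 - 2 * β) * (u ⬝ᵥ A *ᵥ u) ≤ (1 - 2 * β) * (lam Mr' 1 * (u ⬝ᵥ u)) :=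
    mul_le_mul_of_nonneg_left hAu (by linarith [hβ.2])
  have huw : (u + w) ⬝ᵥ As *ᵥ (u + w) ≤ lam Mr' 1 * (u ⬝ᵥ u + w ⬝ᵥ w) := by
    refine le_trans ?_ h22'
    have e1 : (u + w) ⬝ᵥ As *ᵥ (u + w) = u ⬝ᵥ A *ᵥ u + 2 * (u ⬝ᵥ A *ᵥ w) + w ⬝ᵥ A *ᵥ w
        - 2 * (u ⬝ᵥ Amat y *ᵥ u) - 4 * (u ⬝ᵥ Amat y *ᵥ w) - 2 * (w ⬝ᵥ Amat y *ᵥ w) := by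
      rw [hAs]
      simp only [Matrix.sub_mulVec, Matrix.smul_mulVec, Matrix.mulVec_add, dotProduct_add,
        dotProduct_sub, add_dotProduct, dotProduct_smul, smul_eq_mul]
      rw [symm_dot A hA w u, symm_dot (Amat y) (Amat_symm y) w u]
      ring
    rw [e1, hAuw]
    linarith
  have e2 : x ⬝ᵥ As *ᵥ x = q ⬝ᵥ As *ᵥ q + 2 * ((u + w) ⬝ᵥ As *ᵥ q) +
      (u + w) ⬝ᵥ As *ᵥ (u + w) := by
    rw [hdec, Matrix.mulVec_add As q, dotProduct_add, add_dotProduct q, add_dotProduct q,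
      ← hcross']
    ring
  have e3 : x ⬝ᵥ x = q ⬝ᵥ q + (u ⬝ᵥ u + w ⬝ᵥ w) := by
    rw [hdec]
    simp only [dotProduct_add, add_dotProduct]
    rw [dotProduct_comm u q, dotProduct_comm w q, dotProduct_comm w u, oqu, oqw, ouw]
    ring
  rw [e2, e3, hcross]
  linarith
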